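/- arXiv:1604.06359 — 2 statements merged into one kernel-verified Lean document; each statement's English description precedes it below -/
import Mathlib

section
/- Let p be a prime and k ≥ 2 an integer with p ∣ k − 1. Then for every real ε > 0 there exist a natural number n ≥ 1 and a bijection f : ZMod (p^n) → ZMod (p^n) such that f(x + 1) = k·f(x) holds for at least (1 − ε)·p^n elements x of ZMod (p^n) (i.e., the cardinality of {x : f(x+1) = k·f(x)} is at least (1 − ε)·p^n), and f(f(f(f(x)))) = x for all x ∈ ZMod (p^n). -/
/-- The map on words in two letters that fixes the letter `b`, multiplying the parameter `m` by `k`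
as it passes it, and replaces the other letter by a power of it. -/
def wordTwist (k k' : ℕ) (b : Bool) : List Bool → ℕ → List Bool
  | [], _ => []
  | a :: w, m =>
    if a = b then a :: wordTwist k k' b w (m * k)
    else (List.cons a)^[k' ^ m] (wordTwist k k' b w m)

lemma wordTwist_cons_self (k k' : ℕ) (b : Bool) (w : List Bool) (m : ℕ) :
    wordTwist k k' b (b :: w) m = b :: wordTwist k k' b w (m * k) := by
  simp [wordTwist]

lemma wordTwist_cons_of_ne (k k' : ℕ) {a b : Bool} (h : a ≠ b) (w : List Bool) (m : ℕ) :
    wordTwist k k' b (a :: w) m = (List.cons a)^[k' ^ m] (wordTwist k k' b w m) := by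
  simp [wordTwist, h]

lemma wordTwist_iterate_of_ne (k k' : ℕ) {a b : Bool} (h : a ≠ b) (w : List Bool) (m j : ℕ) :
    wordTwist k k' b ((List.cons a)^[j] w) m =
      (List.cons a)^[j * k' ^ m] (wordTwist k k' b w m) := by
  induction j with
  | zero => simp
  | succ j ih =>
    rw [Function.iterate_succ_apply', wordTwist_cons_of_ne k k' h, ih, add_mul, one_mul,
      add_comm (j * _), Function.iterate_add_apply]

lemma wordTwist_add (k k' : ℕ) (b : Bool) (w : List Bool) (m n : ℕ) :
    wordTwist k k' b (wordTwist k k' b w n) m = wordTwist k k' b w (m + n) := by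
  induction w generalizing m n with
  | nil => rfl
  | cons a w ih =>
    by_cases h : a = b
    · subst h
      simp only [wordTwist_cons_self, ih, add_mul]
    · rw [wordTwist_cons_of_ne k k' h, wordTwist_cons_of_ne k k' h, wordTwist_iterate_of_ne k k' h,
        ih, ← pow_add, add_comm n m]

lemma wordTwist_zero (k k' : ℕ) (b : Bool) (w : List Bool) : wordTwist k k' b w 0 = w := by
  induction w with
  | nil => rfl
  | cons a w ih =>
    by_cases h : a = b
    · subst h
      rw [wordTwist_cons_self, zero_mul, ih]
    · rw [wordTwist_cons_of_ne k k' h, ih]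
      simp

section Operators

variable (p : ℕ)

/-- The free `ZMod p`-module over words in two letters. -/
def WordSpace : Type := List Bool →₀ ZMod p

noncomputable instance : AddCommGroup (WordSpace p) :=
  inferInstanceAs (AddCommGroup (List Bool →₀ ZMod p))

noncomputable instance : Module (ZMod p) (WordSpace p) :=
  inferInstanceAs (Module (ZMod p) (List Bool →₀ ZMod p))

instance [Fact p.Prime] : Nontrivial (WordSpace p) :=
  inferInstanceAs (Nontrivial (List Bool →₀ ZMod p))

/-- The basis vector of a word. -/
noncomputable def WordSpace.word (w : List Bool) : WordSpace p := Finsupp.single w 1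

/-- The linear operator on the free vector space over words induced by a map of words. -/
noncomputable def wordOp (g : List Bool → List Bool) :
    Module.End (ZMod p) (WordSpace p) :=
  Finsupp.lmapDomain (ZMod p) (ZMod p) g

/-- Left multiplication by a letter. -/
noncomputable def letterOp (b : Bool) : Module.End (ZMod p) (WordSpace p) :=
  wordOp p (List.cons b)

/-- The linear extension of `wordTwist`. -/
noncomputable def twistOp (k k' : ℕ) (b : Bool) (m : ℕ) :
    Module.End (ZMod p) (WordSpace p) :=
  wordOp p (fun w => wordTwist k k' b w m)

/-- The `s`-th power of the augmentation ideal. -/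
noncomputable def augPow : ℕ → Submodule (ZMod p) (WordSpace p)
  | 0 => ⊤
  | s + 1 => ⨆ b : Bool, (augPow s).map (letterOp p b - 1)

variable {p}

lemma wordOp_mul (g h : List Bool → List Bool) : wordOp p g * wordOp p h = wordOp p (g ∘ h) :=
  (Finsupp.lmapDomain_comp (ZMod p) (ZMod p) h g).symm

lemma wordOp_id : wordOp p id = 1 :=
  Finsupp.lmapDomain_id (ZMod p) (ZMod p)

lemma wordOp_iterate (g : List Bool → List Bool) (n : ℕ) : wordOp p (g^[n]) = wordOp p g ^ n := by
  induction n with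
  | zero => exact wordOp_id
  | succ n ih => rw [Function.iterate_succ, ← wordOp_mul, ih, pow_succ]

lemma wordOp_word (g : List Bool → List Bool) (w : List Bool) :
    wordOp p g (WordSpace.word p w) = WordSpace.word p (g w) :=
  Finsupp.mapDomain_single

lemma letterOp_word (b : Bool) (w : List Bool) :
    letterOp p b (WordSpace.word p w) = WordSpace.word p (b :: w) :=
  wordOp_word _ _

variable (p) in
lemma span_range_word : Submodule.span (ZMod p) (Set.range (WordSpace.word p)) = ⊤ := by
  rw [eq_top_iff]
  intro v _
  have h := Finsupp.mem_span_range_iff_exists_finsupp (R := ZMod p) (v := WordSpace.word p) (x := v)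
  refine h.mpr ⟨v, ?_⟩
  have h2 : ∀ (w : List Bool) (c : ZMod p),
      c • WordSpace.word p w = (Finsupp.single w c : List Bool →₀ ZMod p) := fun w c =>
    (Finsupp.smul_single c w (1 : ZMod p)).trans (by rw [smul_eq_mul, mul_one])
  simp only [h2]
  exact Finsupp.sum_single v

lemma twistOp_zero (k k' : ℕ) (b : Bool) : twistOp p k k' b 0 = 1 := by
  have : (fun w => wordTwist k k' b w 0) = id := funext fun w => wordTwist_zero k k' b w
  rw [twistOp, this, wordOp_id]

lemma twistOp_add (k k' : ℕ) (b : Bool) (m n : ℕ) :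
    twistOp p k k' b (m + n) = twistOp p k k' b m * twistOp p k k' b n := by
  rw [twistOp, twistOp, twistOp, wordOp_mul]
  congr 1
  exact funext fun w => (wordTwist_add k k' b w m n).symm

lemma twistOp_pow (k k' : ℕ) (b : Bool) (m n : ℕ) :
    twistOp p k k' b m ^ n = twistOp p k k' b (m * n) := by
  induction n with
  | zero => simp [twistOp_zero]
  | succ n ih => rw [pow_succ, ih, mul_add, mul_one, twistOp_add]

lemma twistOp_mul_letterOp_self (k k' : ℕ) (b : Bool) (m : ℕ) :
    twistOp p k k' b m * letterOp p b = letterOp p b * twistOp p k k' b (m * k) := by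
  rw [twistOp, twistOp, letterOp, wordOp_mul, wordOp_mul]
  congr 1
  exact funext fun w => wordTwist_cons_self k k' b w m

lemma twistOp_mul_letterOp_of_ne (k k' : ℕ) {a b : Bool} (h : a ≠ b) (m : ℕ) :
    twistOp p k k' b m * letterOp p a = letterOp p a ^ k' ^ m * twistOp p k k' b m := by
  rw [twistOp, letterOp, ← wordOp_iterate, wordOp_mul, wordOp_mul]
  congr 1
  exact funext fun w => wordTwist_cons_of_ne k k' h w m

lemma augPow_succ_le (s : ℕ) : augPow p (s + 1) ≤ augPow p s := by
  induction s with
  | zero => exact le_top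
  | succ s ih => exact iSup_mono fun b => Submodule.map_mono ih

lemma augPow_antitone : Antitone (augPow p) := antitone_nat_of_succ_le augPow_succ_le

lemma letterOp_sub_one_mem {s : ℕ} (b : Bool) {v : WordSpace p} (hv : v ∈ augPow p s) :
    (letterOp p b - 1) v ∈ augPow p (s + 1) :=
  Submodule.mem_iSup_of_mem b (Submodule.mem_map_of_mem hv)

lemma letterOp_sub_one_pow_mem {s : ℕ} (b : Bool) (n : ℕ) {v : WordSpace p}
    (hv : v ∈ augPow p s) : ((letterOp p b - 1) ^ n) v ∈ augPow p (s + n) := by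
  induction n with
  | zero => simpa using hv
  | succ n ih =>
    rw [pow_succ']
    exact letterOp_sub_one_mem b ih

lemma letterOp_mem {s : ℕ} (b : Bool) {v : WordSpace p} (hv : v ∈ augPow p s) :
    letterOp p b v ∈ augPow p s := by
  have h : letterOp p b v = (letterOp p b - 1) v + v := by simp
  rw [h]
  exact add_mem (augPow_succ_le s (letterOp_sub_one_mem b hv)) hv

lemma letterOp_pow_mem {s : ℕ} (b : Bool) (n : ℕ) {v : WordSpace p}
    (hv : v ∈ augPow p s) : (letterOp p b ^ n) v ∈ augPow p s := by
  induction n with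
  | zero => simpa using hv
  | succ n ih =>
    rw [pow_succ']
    exact letterOp_mem b ih

lemma letterOp_pow_sub_one_mem [Fact p.Prime] {s e c : ℕ} (b : Bool) (hc : p ^ e ∣ c)
    {v : WordSpace p} (hv : v ∈ augPow p s) :
    (letterOp p b ^ c - 1) v ∈ augPow p (s + p ^ e) := by
  obtain ⟨d, rfl⟩ := hc
  induction d with
  | zero => simp
  | succ d ih =>
    have hchar : CharP (Module.End (ZMod p) (WordSpace p)) p :=
      charP_of_injective_algebraMap
        (algebraMap (ZMod p) (Module.End (ZMod p) (WordSpace p))).injective p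
    have h1 : (letterOp p b - 1) ^ p ^ e = letterOp p b ^ p ^ e - 1 := by
      rw [sub_pow_char_pow_of_commute _ _ (Commute.one_right _), one_pow]
    have h2 : letterOp p b ^ (p ^ e * (d + 1)) - 1 =
        (letterOp p b - 1) ^ p ^ e * letterOp p b ^ (p ^ e * d) +
          (letterOp p b ^ (p ^ e * d) - 1) := by
      rw [h1, mul_add, mul_one, add_comm, pow_add]
      noncomm_ring
    rw [h2]
    exact add_mem (letterOp_sub_one_pow_mem b _ (letterOp_pow_mem b _ hv)) ih

lemma pow_pow_mul_sub_one_dvd {k' : ℕ} (hk' : p ∣ k' - 1) (h1 : 1 ≤ k') (e m : ℕ) :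
    p ^ (e + 1) ∣ k' ^ (p ^ e * m) - 1 := by
  have h : (p : ℤ) ∣ (k' : ℤ) - 1 := by
    have := Int.natCast_dvd_natCast.mpr hk'
    rwa [Nat.cast_sub h1, Nat.cast_one] at this
  have h2 := (dvd_sub_pow_of_dvd_sub h e).trans
    (sub_dvd_pow_sub_pow ((k' : ℤ) ^ p ^ e) (1 ^ p ^ e) m)
  rw [one_pow, one_pow, ← pow_mul] at h2
  have h3 : 1 ≤ k' ^ (p ^ e * m) := Nat.one_le_pow _ _ h1
  rw [← Int.natCast_dvd_natCast]
  push_cast [Nat.cast_sub h3]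
  exact h2

lemma letterOp_pow_sub_letterOp_mem [Fact p.Prime] {k' : ℕ} (hk' : p ∣ k' - 1) (h1 : 1 ≤ k')
    (e m : ℕ) {s : ℕ} (b : Bool) {v : WordSpace p} (hv : v ∈ augPow p s) :
    (letterOp p b ^ k' ^ (p ^ e * m) - letterOp p b) v ∈ augPow p (s + e + 2) := by
  have h3 : 1 ≤ k' ^ (p ^ e * m) := Nat.one_le_pow _ _ h1
  have h4 : letterOp p b ^ k' ^ (p ^ e * m) - letterOp p b =
      letterOp p b * (letterOp p b ^ (k' ^ (p ^ e * m) - 1) - 1) := by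
    rw [mul_sub, ← pow_succ', Nat.sub_add_cancel h3, mul_one]
  have h5 : e + 2 ≤ p ^ (e + 1) := (Nat.lt_pow_self (Fact.out : p.Prime).one_lt (n := e + 1))
  rw [h4]
  refine augPow_antitone (by omega) (letterOp_mem b
    (letterOp_pow_sub_one_mem b (pow_pow_mul_sub_one_dvd hk' h1 e m) hv))

lemma twistOp_sub_one_word_mem [Fact p.Prime] {k k' : ℕ} (hk' : p ∣ k' - 1) (h1 : 1 ≤ k')
    (b : Bool) (w : List Bool) (e m : ℕ) :
    (twistOp p k k' b (p ^ e * m) - 1) (WordSpace.word p w) ∈ augPow p (e + 1) := by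
  induction w generalizing m with
  | nil =>
    simp [twistOp, wordOp_word, wordTwist]
  | cons a w ih =>
    rw [← letterOp_word]
    set v := WordSpace.word p w
    by_cases h : a = b
    · subst h
      have : (twistOp p k k' a (p ^ e * m) - 1) * letterOp p a =
          letterOp p a * (twistOp p k k' a (p ^ e * (m * k)) - 1) := by
        rw [sub_mul, twistOp_mul_letterOp_self, mul_assoc]
        noncomm_ring
      rw [← Module.End.mul_apply, this]
      exact letterOp_mem a (ih _)
    · have : (twistOp p k k' b (p ^ e * m) - 1) * letterOp p a =
          letterOp p a ^ k' ^ (p ^ e * m) * (twistOp p k k' b (p ^ e * m) - 1) +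
            (letterOp p a ^ k' ^ (p ^ e * m) - letterOp p a) := by
        rw [sub_mul, twistOp_mul_letterOp_of_ne k k' h]
        noncomm_ring
      rw [← Module.End.mul_apply, this]
      refine add_mem (letterOp_pow_mem a _ (ih m)) (augPow_antitone ?_
        (letterOp_pow_sub_letterOp_mem hk' h1 e m a (s := 0) trivial))
      omega

lemma twistOp_sub_one_mem [Fact p.Prime] {k k' : ℕ} (hk : p ∣ k - 1) (hk1 : 1 ≤ k)
    (hk' : p ∣ k' - 1) (hk1' : 1 ≤ k') (b : Bool) (s e m : ℕ) :
    augPow p s ≤ (augPow p (s + e + 1)).comap (twistOp p k k' b (p ^ e * m) - 1) := by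
  induction s generalizing e m with
  | zero =>
    refine le_trans (span_range_word p).ge (Submodule.span_le.mpr ?_)
    rintro _ ⟨w, rfl⟩
    have := twistOp_sub_one_word_mem (p := p) (k := k) hk' hk1' b w e m
    simpa [add_comm] using this
  | succ s ih =>
    have hT : ∀ m, ∀ v ∈ augPow p s, twistOp p k k' b (p ^ e * m) v ∈ augPow p s := by
      intro m v hv
      have h := add_mem (augPow_antitone (by omega : s ≤ s + e + 1) (ih e m hv)) hv
      simpa using h
    refine iSup_le fun a => Submodule.map_le_iff_le_comap.mpr fun (v : WordSpace p) hv => ?_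
    change (twistOp p k k' b (p ^ e * m) - 1) ((letterOp p a - 1) v) ∈ augPow p (s + 1 + e + 1)
    rw [← Module.End.mul_apply]
    by_cases h : a = b
    · subst h
      obtain ⟨c, hc⟩ := hk
      have hm : p ^ e * m * k = p ^ (e + 1) * (m * c) + p ^ e * m := by
        have : k = p * c + 1 := by omega
        rw [this]
        ring
      have : (twistOp p k k' a (p ^ e * m) - 1) * (letterOp p a - 1) =
          (letterOp p a - 1) * (twistOp p k k' a (p ^ e * (m * k)) - 1) +
            (twistOp p k k' a (p ^ (e + 1) * (m * c)) - 1) * twistOp p k k' a (p ^ e * m) := by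
        rw [sub_mul (twistOp p k k' a (p ^ (e + 1) * (m * c))), ← twistOp_add, ← hm, sub_mul,
          mul_sub, twistOp_mul_letterOp_self, mul_assoc (p ^ e)]
        noncomm_ring
      rw [this]
      have e1 := letterOp_sub_one_mem a (Submodule.mem_comap.mp (ih e (m * k) hv))
      have e2 := Submodule.mem_comap.mp (ih (e + 1) (m * c) (hT m v hv))
      exact add_mem (augPow_antitone (by omega) e1) (augPow_antitone (by omega) e2)
    · have : (twistOp p k k' b (p ^ e * m) - 1) * (letterOp p a - 1) =
          (letterOp p a - 1) * (twistOp p k k' b (p ^ e * m) - 1) +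
            (letterOp p a ^ k' ^ (p ^ e * m) - letterOp p a) * twistOp p k k' b (p ^ e * m) := by
        rw [sub_mul, mul_sub, twistOp_mul_letterOp_of_ne k k' h]
        noncomm_ring
      rw [this]
      have e1 := letterOp_sub_one_mem a (Submodule.mem_comap.mp (ih e m hv))
      have e2 := letterOp_pow_sub_letterOp_mem hk' hk1' e m a (hT m v hv)
      exact add_mem (augPow_antitone (by omega) e1) (augPow_antitone (by omega) e2)

lemma exists_fg_sup_augPow_eq_top (s : ℕ) :
    ∃ F : Submodule (ZMod p) (WordSpace p), F.FG ∧ F ⊔ augPow p s = ⊤ := by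
  induction s with
  | zero => exact ⟨⊥, Submodule.fg_bot, by simp [augPow]⟩
  | succ s ih =>
    obtain ⟨F, hF, htop⟩ := ih
    refine ⟨Submodule.span (ZMod p) {WordSpace.word p []} ⊔
      ⨆ b : Bool, F.map (letterOp p b - 1), (Submodule.fg_span_singleton _).sup
        (Submodule.fg_iSup _ fun b => hF.map _), ?_⟩
    have hmap : ∀ (b : Bool) (v : WordSpace p), (letterOp p b - 1) v ∈
        (⨆ b : Bool, F.map (letterOp p b - 1)) ⊔ augPow p (s + 1) := by
      intro b v
      have hv : v ∈ F ⊔ augPow p s := htop ▸ trivial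
      obtain ⟨u, hu, w, hw, rfl⟩ := Submodule.mem_sup.mp hv
      rw [map_add]
      exact Submodule.add_mem_sup
        (Submodule.mem_iSup_of_mem b (Submodule.mem_map_of_mem hu)) (letterOp_sub_one_mem b hw)
    rw [eq_top_iff, ← span_range_word p, Submodule.span_le]
    rintro _ ⟨w, rfl⟩
    induction w with
    | nil =>
      exact Submodule.mem_sup_left (Submodule.mem_sup_left (Submodule.mem_span_singleton_self _))
    | cons b w ih =>
      have h : WordSpace.word p (b :: w) =
          (letterOp p b - 1) (WordSpace.word p w) + WordSpace.word p w := by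
        rw [← letterOp_word]
        simp
      rw [h]
      refine add_mem ?_ ih
      rw [sup_assoc]
      exact Submodule.mem_sup_right (hmap b _)

lemma finite_quotient_augPow [Fact p.Prime] (s : ℕ) : Finite (WordSpace p ⧸ augPow p s) := by
  obtain ⟨F, hF, htop⟩ := exists_fg_sup_augPow_eq_top (p := p) s
  have h : F.map (augPow p s).mkQ = ⊤ := by
    have h := congrArg (Submodule.map (augPow p s).mkQ) htop
    rwa [Submodule.map_sup, Submodule.mkQ_map_self, sup_bot_eq, Submodule.map_top,
      Submodule.range_mkQ] at h
  have : Module.Finite (ZMod p) (WordSpace p ⧸ augPow p s) := ⟨h ▸ hF.map _⟩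
  exact Module.finite_of_finite (ZMod p)

open Polynomial in
lemma letterOp_pow_ne_one_mod_augPow [Fact p.Prime] (b : Bool) (n : ℕ) :
    (letterOp p b ^ p ^ n - 1) (WordSpace.word p []) ∉ augPow p (p ^ n + 1) := by
  let l : WordSpace p →ₗ[ZMod p] (ZMod p)[X] :=
    Finsupp.linearCombination (ZMod p) fun w : List Bool => (1 + X) ^ w.count b
  have hl : ∀ w, l (WordSpace.word p w) = (1 + X) ^ w.count b := fun w =>
    (Finsupp.linearCombination_single (ZMod p) 1 w).trans (one_smul _ _)
  have hself : ∀ v, l (letterOp p b v) = (1 + X) * l v := by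
    intro v
    have : l ∘ₗ letterOp p b = LinearMap.mulLeft (ZMod p) (1 + X) ∘ₗ l := by
      refine LinearMap.ext_on_range (span_range_word p) fun w => ?_
      simp [letterOp_word, hl, pow_succ']
    exact LinearMap.congr_fun this v
  have hne : ∀ a, a ≠ b → ∀ v, l (letterOp p a v) = l v := by
    intro a ha v
    have : l ∘ₗ letterOp p a = l := by
      refine LinearMap.ext_on_range (span_range_word p) fun w => ?_
      simp [letterOp_word, hl, ha]
    exact LinearMap.congr_fun this v
  have hdvd : ∀ s, augPow p s ≤
      (Submodule.restrictScalars (ZMod p) (Ideal.span {(X : (ZMod p)[X]) ^ s})).comap l := by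
    intro s
    induction s with
    | zero => intro v _; simp
    | succ s ih =>
      refine iSup_le fun a => Submodule.map_le_iff_le_comap.mpr fun (v : WordSpace p) hv => ?_
      have h := ih hv
      simp only [Submodule.mem_comap, Submodule.restrictScalars_mem,
        Ideal.mem_span_singleton, LinearMap.sub_apply, Module.End.one_apply, map_sub] at h ⊢
      by_cases ha : a = b
      · subst ha
        rw [hself, add_mul, one_mul, add_sub_cancel_left, pow_succ']
        exact mul_dvd_mul_left _ h
      · rw [hne a ha, sub_self]
        exact dvd_zero _
  intro hmem
  have h := hdvd _ hmem
  have hpow : ∀ j, l ((letterOp p b ^ j) (WordSpace.word p [])) = (1 + X) ^ j := by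
    intro j
    induction j with
    | zero => simp [hl]
    | succ j ih => rw [pow_succ', Module.End.mul_apply, hself, ih, pow_succ']
  simp only [Submodule.mem_comap, Submodule.restrictScalars_mem, Ideal.mem_span_singleton,
    LinearMap.sub_apply, map_sub, hpow, Module.End.one_apply, hl, List.count_nil, pow_zero,
    add_pow_char_pow, one_pow, add_sub_cancel_left] at h
  have := (X_pow_dvd_iff.mp h) (p ^ n) (Nat.lt_succ_self _)
  simp at this

end Operators

/-- The operators acting trivially on the graded pieces of a decreasing filtration. -/
def unipotentSubmonoid {R V : Type*} [CommRing R] [AddCommGroup V] [Module R V]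
    (J : ℕ → Submodule R V) (hJ : Antitone J) : Submonoid (Module.End R V) where
  carrier := {g | ∀ s, J s ≤ (J (s + 1)).comap (g - 1)}
  one_mem' := fun s v _ => by simp
  mul_mem' := by
    intro g h hg hh s v hv
    have h1 : g * h - 1 = (g - 1) * (h - 1) + (g - 1) + (h - 1) := by noncomm_ring
    rw [Submodule.mem_comap, h1]
    exact add_mem (add_mem (hg s (hJ (Nat.le_succ s) (hh s hv))) (hg s hv)) (hh s hv)

lemma pow_eq_one_of_mem_unipotentSubmonoid {p : ℕ} [Fact p.Prime] {V : Type*} [AddCommGroup V]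
    [Module (ZMod p) V] [Nontrivial V] {J : ℕ → Submodule (ZMod p) V} {hJ : Antitone J}
    (htop : J 0 = ⊤) {e : ℕ} (hbot : J (p ^ e) = ⊥) {g : Module.End (ZMod p) V}
    (hg : g ∈ unipotentSubmonoid J hJ) : g ^ p ^ e = 1 := by
  have hchar : CharP (Module.End (ZMod p) V) p :=
    charP_of_injective_algebraMap (algebraMap (ZMod p) (Module.End (ZMod p) V)).injective p
  have h : ∀ (n : ℕ) (v : V), ((g - 1) ^ n) v ∈ J n := by
    intro n v
    induction n with
    | zero => rw [htop]; trivial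
    | succ n ih =>
      rw [pow_succ', Module.End.mul_apply]
      exact hg n ih
  have h0 : (g - 1) ^ p ^ e = 0 := by
    ext v
    have := h (p ^ e) v
    rwa [hbot, Submodule.mem_bot] at this
  rw [sub_pow_char_pow_of_commute _ _ (Commute.one_right _), one_pow, sub_eq_zero] at h0
  exact h0

/-- Finite `p`-groups satisfying the cyclic relations of the generalized Higman group in which
the generators have arbitrarily large order. -/
lemma exists_higman_pGroup {p k : ℕ} (hp : p.Prime) (hk : 1 ≤ k) (hdvd : p ∣ k - 1) (n : ℕ) :
    ∃ (P : Type) (_ : Group P) (_ : Finite P) (b : Fin 4 → P), IsPGroup p P ∧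
      (∀ i, b (i + 1) * b i * (b (i + 1))⁻¹ = b i ^ k) ∧ p ^ n ∣ orderOf (b 0) := by
  have := Fact.mk hp
  set N := p ^ n + 1 with hN
  set k' := k ^ (p ^ (n + 1) - 1) with hk'
  have hpos : 0 < p ^ (n + 1) := pow_pos hp.pos _
  have hkk' : k' * k = k ^ p ^ (n + 1) := by
    rw [hk', ← pow_succ, Nat.sub_add_cancel hpos]
  have h1k' : 1 ≤ k' := Nat.one_le_pow _ _ hk
  have hpk' : p ∣ k' - 1 := by
    have := pow_pow_mul_sub_one_dvd hdvd hk 0 (p ^ (n + 1) - 1)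
    simpa using this
  let Q := WordSpace p ⧸ augPow p N
  have hQfin : Finite Q := finite_quotient_augPow N
  let J : ℕ → Submodule (ZMod p) Q := fun s => (augPow p s).map (augPow p N).mkQ
  have hJ : Antitone J := fun s t h => Submodule.map_mono (augPow_antitone h)
  have htop : J 0 = ⊤ := by
    change Submodule.map _ ⊤ = ⊤
    rw [Submodule.map_top, Submodule.range_mkQ]
  have hNle : N ≤ p ^ (n + 1) := Nat.pow_lt_pow_right hp.one_lt (Nat.lt_succ_self n)
  have hbot : J (p ^ (n + 1)) = ⊥ := by
    rw [eq_bot_iff]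
    exact (hJ hNle).trans (Submodule.mkQ_map_self _).le
  have hnontriv : Nontrivial Q := by
    refine ⟨(augPow p N).mkQ ((letterOp p false ^ p ^ n - 1) (WordSpace.word p [])), 0, fun h => ?_⟩
    exact letterOp_pow_ne_one_mod_augPow false n ((Submodule.Quotient.mk_eq_zero _).mp h)
  let M₀ := unipotentSubmonoid (augPow p) augPow_antitone
  let M := unipotentSubmonoid J hJ
  have hMpow : ∀ g : M, g ^ p ^ (n + 1) = 1 := fun g =>
    Subtype.ext (pow_eq_one_of_mem_unipotentSubmonoid htop hbot g.2)
  have hmapQ : ∀ g : M₀, augPow p N ≤ (augPow p N).comap g.1 := by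
    intro g v hv
    have h := add_mem (augPow_succ_le N (g.2 N hv)) hv
    simpa using h
  let φ : M₀ →* M :=
    { toFun := fun g => ⟨(augPow p N).mapQ _ g.1 (hmapQ g), by
        rintro s _ ⟨v, hv, rfl⟩
        exact ⟨(g.1 - 1) v, g.2 s hv, rfl⟩⟩
      map_one' := by
        refine Subtype.ext (LinearMap.ext fun v => ?_)
        obtain ⟨v, rfl⟩ := Submodule.mkQ_surjective _ v
        rfl
      map_mul' := fun g h => by
        refine Subtype.ext (LinearMap.ext fun v => ?_)
        obtain ⟨v, rfl⟩ := Submodule.mkQ_surjective _ v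
        rfl }
  let u : M → Mˣ := fun g => Units.ofPowEqOne g (p ^ (n + 1)) (hMpow g) hpos.ne'
  let L : Bool → M₀ := fun b => ⟨letterOp p b, fun s v hv => letterOp_sub_one_mem b hv⟩
  let T : Bool → M₀ := fun b => ⟨twistOp p k k' b 1, fun s v hv => by
    have := twistOp_sub_one_mem hdvd hk hpk' h1k' b s 0 1 hv
    simpa using this⟩
  have hself : ∀ b, u (φ (L b)) * u (φ (T b)) ^ k = u (φ (T b)) * u (φ (L b)) := by
    intro b
    refine Units.ext ?_
    change φ (L b) * φ (T b) ^ k = φ (T b) * φ (L b)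
    rw [← map_pow, ← map_mul, ← map_mul]
    refine congrArg φ (Subtype.ext ?_)
    change letterOp p b * twistOp p k k' b 1 ^ k = twistOp p k k' b 1 * letterOp p b
    rw [twistOp_pow, twistOp_mul_letterOp_self]
  have hne : ∀ a b, a ≠ b →
      u (φ (T b)) * u (φ (L a)) ^ k = u (φ (L a)) * u (φ (T b)) := by
    intro a b hab
    refine Units.ext ?_
    change φ (T b) * φ (L a) ^ k = φ (L a) * φ (T b)
    have h1 : φ (T b) * φ (L a) = φ (L a) ^ k' * φ (T b) := by
      rw [← map_pow, ← map_mul, ← map_mul]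
      refine congrArg φ (Subtype.ext ?_)
      change twistOp p k k' b 1 * letterOp p a = letterOp p a ^ k' * twistOp p k k' b 1
      rw [twistOp_mul_letterOp_of_ne k k' hab, pow_one]
    have h2 : φ (T b) * φ (L a) ^ k = φ (L a) ^ (k' * k) * φ (T b) := by
      have : SemiconjBy (φ (T b)) (φ (L a)) (φ (L a) ^ k') := h1
      rw [pow_mul]
      exact this.pow_right k
    obtain ⟨c, hc⟩ := pow_pow_mul_sub_one_dvd hdvd hk (n + 1) 1
    have h3 : k' * k = p ^ (n + 1) * (p * c) + 1 := by
      have : 1 ≤ k ^ p ^ (n + 1) := Nat.one_le_pow _ _ hk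
      rw [hkk', ← mul_assoc, ← pow_succ, ← hc, mul_one, Nat.sub_add_cancel this]
    rw [h2, h3, pow_succ, pow_mul, hMpow, one_pow, one_mul]
  have hconj : ∀ x y : Mˣ, x * y ^ k = y * x → x⁻¹ * y⁻¹ * x⁻¹⁻¹ = y⁻¹ ^ k := by
    intro x y h
    rw [inv_inv, inv_pow, eq_inv_iff_mul_eq_one, mul_assoc, h]
    group
  have hP : IsPGroup p Mˣ := fun g => ⟨n + 1, Units.ext (by simpa using hMpow g.1)⟩
  have hfin : Finite (Module.End (ZMod p) Q) := Module.finite_of_finite (ZMod p)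
  refine ⟨Mˣ, inferInstance, inferInstance, ![(u (φ (L false)))⁻¹, (u (φ (T true)))⁻¹,
    (u (φ (L true)))⁻¹, (u (φ (T false)))⁻¹], hP, ?_, ?_⟩
  · intro i
    fin_cases i
    · exact hconj _ _ (hne false true (by simp))
    · exact hconj _ _ (hself true)
    · exact hconj _ _ (hne true false (by simp))
    · exact hconj _ _ (hself false)
  · change p ^ n ∣ orderOf (u (φ (L false)))⁻¹
    rw [orderOf_inv]
    obtain ⟨j, hj⟩ := (IsPGroup.iff_orderOf.mp hP) (u (φ (L false)))
    rw [hj]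
    refine pow_dvd_pow p (le_of_not_gt fun hlt => ?_)
    have h1 : u (φ (L false)) ^ p ^ n = 1 :=
      orderOf_dvd_iff_pow_eq_one.mp (hj ▸ pow_dvd_pow p hlt.le)
    have h2 : φ (L false ^ p ^ n) = 1 := by
      rw [map_pow]
      exact congrArg Units.val h1
    have h3 := LinearMap.congr_fun (congrArg Subtype.val h2)
      ((augPow p N).mkQ (WordSpace.word p []))
    exact letterOp_pow_ne_one_mod_augPow false n ((Submodule.Quotient.eq _).mp h3)

lemma exists_extend_translation {G R : Type*} [Group G] [AddCommMonoid R] (H : Subgroup G)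
    (χ : G → R) : ∃ h : G → R, ∀ g ∈ H, ∀ c, (∀ z ∈ H, χ (g * z) = χ z + c) →
      ∀ x, h (g * x) = h x + c := by
  let r : G → G := fun x => (Quotient.mk (QuotientGroup.rightRel H) x).out
  have hr : ∀ x, x * (r x)⁻¹ ∈ H := fun x => by
    have h : (QuotientGroup.rightRel H) (r x) x := Quotient.mk_out (s := QuotientGroup.rightRel H) x
    exact QuotientGroup.rightRel_apply.mp h
  have hrg : ∀ g ∈ H, ∀ x, r (g * x) = r x := fun g hg x => by
    have : Quotient.mk (QuotientGroup.rightRel H) (g * x) =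
        Quotient.mk (QuotientGroup.rightRel H) x := by
      refine Quotient.sound (QuotientGroup.rightRel_apply.mpr ?_)
      simpa using hg
    simp only [r, this]
  refine ⟨fun x => χ (x * (r x)⁻¹), fun g hg c hc x => ?_⟩
  simp only [hrg g hg, mul_assoc]
  exact hc _ (hr x)

lemma exists_zmod_translation {G : Type*} [Group G] (g : G) {L : ℕ} (hL : L ∣ orderOf g) :
    ∃ u : G → ZMod L, ∀ x, u (g * x) = u x + 1 := by
  choose! a ha using fun z (hz : z ∈ Subgroup.zpowers g) => Subgroup.mem_zpowers_iff.mp hz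
  obtain ⟨h, hh⟩ := exists_extend_translation (Subgroup.zpowers g) (fun z => (a z : ZMod L))
  refine ⟨h, hh g (Subgroup.mem_zpowers g) 1 fun z hz => ?_⟩
  have hgz := mul_mem (Subgroup.mem_zpowers g) hz
  have h1 : g ^ (a (g * z) - (a z + 1)) = 1 := by
    rw [zpow_sub, ha _ hgz, zpow_add_one, ha z hz, mul_inv_eq_one]
    have : Commute g z := by
      rw [← ha z hz]
      exact Commute.self_zpow g _
    exact this
  have h2 : (L : ℤ) ∣ a (g * z) - (a z + 1) :=
    (Int.natCast_dvd_natCast.mpr hL).trans (orderOf_dvd_iff_zpow_eq_one.mpr h1)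
  have h3 := (ZMod.intCast_eq_intCast_iff_dvd_sub _ _ L).mpr h2
  push_cast at h3
  exact h3.symm

section Conj

variable {G : Type*} [Group G] {α β : G} {k : ℕ}

lemma pow_conj_eq (h : β * α * β⁻¹ = α ^ k) (i : ℕ) : β ^ i * α * (β ^ i)⁻¹ = α ^ k ^ i := by
  induction i with
  | zero => simp
  | succ i ih =>
    have h1 : β ^ (i + 1) * α * (β ^ (i + 1))⁻¹ = β * (β ^ i * α * (β ^ i)⁻¹) * β⁻¹ := by
      rw [pow_succ']
      group
    rw [h1, ih, ← conj_pow, h, ← pow_mul, pow_succ']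

lemma conj_zpow_eq (h : β * α * β⁻¹ = α ^ k) (a : ℤ) : β * α ^ a = α ^ (k * a) * β := by
  rw [zpow_mul, zpow_natCast, ← h, conj_zpow]
  group

lemma exists_zpow_mul_zpow_of_mem_closure (h : β * α * β⁻¹ = α ^ k) (hα : IsOfFinOrder α)
    (hk : (orderOf α).Coprime k) {z : G} (hz : z ∈ Subgroup.closure {α, β}) :
    ∃ a b : ℤ, z = α ^ a * β ^ b := by
  obtain ⟨k', hk'⟩ : ∃ k' : ℤ, α ^ (k * k') = α := by
    refine ⟨Int.gcdB (orderOf α) k, ?_⟩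
    have h1 := Int.gcd_eq_gcd_ab (orderOf α) k
    rw [Int.gcd_natCast_natCast, hk.gcd_eq_one] at h1
    have h2 : (k : ℤ) * Int.gcdB (orderOf α) k =
        1 - orderOf α * Int.gcdA (orderOf α) k := by
      push_cast at h1
      linarith
    rw [h2, zpow_sub, zpow_mul, zpow_natCast, pow_orderOf_eq_one]
    simp
  induction hz using Subgroup.closure_induction_left with
  | one => exact ⟨0, 0, by simp⟩
  | mul_left x hx y _ ih =>
    obtain ⟨a, b, rfl⟩ := ih
    rcases hx with rfl | rfl
    · exact ⟨a + 1, b, by rw [← mul_assoc, zpow_add, zpow_one, ← zpow_one_add, add_comm, zpow_add,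
        zpow_one]⟩
    · exact ⟨k * a, b + 1, by rw [← mul_assoc, conj_zpow_eq h, mul_assoc, ← zpow_one_add,
        add_comm]⟩
  | inv_mul_cancel x hx y _ ih =>
    obtain ⟨a, b, rfl⟩ := ih
    rcases hx with rfl | rfl
    · exact ⟨a - 1, b, by rw [← mul_assoc, ← zpow_neg_one, ← zpow_add, add_comm]; rfl⟩
    · refine ⟨k' * a, b - 1, ?_⟩
      have h1 := conj_zpow_eq h (k' * a)
      have h2 : α ^ ((k : ℤ) * (k' * a)) = α ^ a := by rw [← mul_assoc, zpow_mul, hk']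
      rw [h2] at h1
      rw [inv_mul_eq_iff_eq_mul, ← mul_assoc, h1, mul_assoc, ← zpow_one_add, add_sub_cancel]

lemma dvd_of_commute_zpow {p n s : ℕ} (hp : p.Prime) (h : β * α * β⁻¹ = α ^ k) (hk : 2 ≤ k)
    (hα : p ^ n ∣ orderOf α) {N : ℕ} (hβ : β ^ p ^ N = 1) (hn : k ^ p ^ s < p ^ n) {d : ℤ}
    (hd : Commute (β ^ d) α) : ((p ^ s : ℕ) : ℤ) ∣ d := by
  have hgcd : Commute (β ^ (Int.gcd d (p ^ N : ℕ))) α := by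
    have h1 := Int.gcd_eq_gcd_ab d (p ^ N : ℕ)
    have h2 : β ^ (Int.gcd d (p ^ N : ℕ)) = (β ^ d) ^ Int.gcdA d (p ^ N : ℕ) := by
      rw [← zpow_natCast β, h1, zpow_add, zpow_mul, zpow_mul, zpow_natCast, hβ, one_zpow, mul_one]
    rw [h2]
    exact hd.zpow_left _
  obtain ⟨j, hj, hcj⟩ := (Nat.dvd_prime_pow hp).mp
    (Int.natCast_dvd_natCast.mp (Int.gcd_dvd_right d (p ^ N : ℕ)))
  rcases le_or_gt s j with hsj | hsj
  · refine (Int.natCast_dvd_natCast.mpr (pow_dvd_pow p hsj)).trans ?_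
    rw [← hcj]
    exact Int.gcd_dvd_left d (p ^ N : ℕ)
  · exfalso
    rw [hcj] at hgcd
    have h1 := pow_conj_eq h (p ^ j)
    rw [hgcd.eq, mul_inv_cancel_right] at h1
    have hlt : 1 < k ^ p ^ j := Nat.one_lt_pow (pow_pos hp.pos j).ne' (by omega)
    have h2 : α ^ (k ^ p ^ j - 1) = 1 := by
      refine mul_right_cancel (b := α) ?_
      rw [← pow_succ, Nat.sub_add_cancel hlt.le, one_mul]
      exact h1.symm
    have h3 := Nat.le_of_dvd (by omega) (hα.trans (orderOf_dvd_of_pow_eq_one h2))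
    have h4 : k ^ p ^ j ≤ k ^ p ^ s :=
      Nat.pow_le_pow_right (by omega) (Nat.pow_le_pow_right hp.pos hsj.le)
    omega

/-- A finite `p`-group is tiled by translates of a Følner set of the Baumslag–Solitar group. -/
lemma exists_group_tiling [Finite G] {p n s l : ℕ} (hp : p.Prime) (hG : IsPGroup p G)
    (h : β * α * β⁻¹ = α ^ k) (hk : 2 ≤ k) (hdvd : p ∣ k - 1) (hα : p ^ n ∣ orderOf α)
    (hn : k ^ p ^ s < p ^ n) (hl : l ≤ n) :
    ∃ C : Set G, Function.Bijective fun t : C × Fin (p ^ l) × Fin (p ^ s) =>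
      (β ^ (t.2.2 : ℕ))⁻¹ * (α ^ (t.2.1 : ℕ) * t.1) := by
  have := Fact.mk hp
  have : NeZero (p ^ l) := ⟨(pow_pos hp.pos l).ne'⟩
  have : NeZero (p ^ s) := ⟨(pow_pos hp.pos s).ne'⟩
  obtain ⟨u, hu⟩ := exists_zmod_translation α ((pow_dvd_pow p hl).trans hα)
  have hcop : (orderOf α).Coprime k := by
    obtain ⟨j, hj⟩ := (IsPGroup.iff_orderOf.mp hG) α
    rw [hj]
    refine Nat.Coprime.pow_left j ((Nat.Prime.coprime_iff_not_dvd hp).mpr fun hpk => ?_)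
    have := (Nat.dvd_sub hpk hdvd)
    rw [Nat.sub_sub_self (by omega)] at this
    exact hp.one_lt.ne' (Nat.dvd_one.mp this)
  obtain ⟨N, hN⟩ := hG β
  choose! a b hab using fun z (hz : z ∈ Subgroup.closure {α, β}) =>
    exists_zpow_mul_zpow_of_mem_closure h (isOfFinOrder_of_finite α) hcop hz
  have huniq : ∀ c d e f : ℤ, α ^ c * β ^ d = α ^ e * β ^ f → (d : ZMod (p ^ s)) = f := by
    intro c d e f heq
    rw [ZMod.intCast_eq_intCast_iff_dvd_sub]
    refine dvd_of_commute_zpow hp h hk hα hN hn ?_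
    have h1 : β ^ (f - d) = α ^ (c - e) := by
      have : β ^ f = α ^ (-e) * (α ^ c * β ^ d) := by
        rw [heq]
        group
      rw [zpow_sub, this]
      group
    rw [h1]
    exact Commute.zpow_self α _
  obtain ⟨v, hv⟩ := exists_extend_translation (Subgroup.closure {α, β})
    (fun z => (b z : ZMod (p ^ s)))
  have hαmem : α ∈ Subgroup.closure {α, β} := Subgroup.subset_closure (by simp)
  have hβmem : β ∈ Subgroup.closure {α, β} := Subgroup.subset_closure (by simp)
  have hvα : ∀ x, v (α * x) = v x := by
    intro x
    have := hv α hαmem 0 (fun z hz => ?_) x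
    · simpa using this
    · rw [add_zero]
      refine huniq (a (α * z)) _ (1 + a z) _ ?_
      rw [← hab _ (mul_mem hαmem hz), zpow_one_add, mul_assoc, ← hab z hz]
  have hvβ : ∀ x, v (β * x) = v x + 1 := by
    refine hv β hβmem 1 fun z hz => ?_
    have := huniq (a (β * z)) (b (β * z)) (k * a z) (b z + 1) (by
      rw [← hab _ (mul_mem hβmem hz), add_comm, zpow_one_add, ← mul_assoc, ← conj_zpow_eq h,
        mul_assoc, ← hab z hz])
    rw [this]
    push_cast
    rfl
  have hvα' : ∀ (i : ℕ) x, v (α ^ i * x) = v x := by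
    intro i x
    induction i with
    | zero => simp
    | succ i ih => rw [pow_succ', mul_assoc, hvα, ih]
  have hvβ' : ∀ (i : ℕ) x, v (β ^ i * x) = v x + i := by
    intro i x
    induction i with
    | zero => simp
    | succ i ih =>
      rw [pow_succ', mul_assoc, hvβ, ih]
      push_cast
      ring
  have hu' : ∀ (i : ℕ) x, u (α ^ i * x) = u x + i := by
    intro i x
    induction i with
    | zero => simp
    | succ i ih =>
      rw [pow_succ', mul_assoc, hu, ih]
      push_cast
      ring
  have hfin : ∀ (m : ℕ) (x y : Fin m), ((x : ℕ) : ZMod m) = ((y : ℕ) : ZMod m) → x = y := by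
    intro m x y hxy
    rw [ZMod.natCast_eq_natCast_iff'] at hxy
    rw [Nat.mod_eq_of_lt x.2, Nat.mod_eq_of_lt y.2] at hxy
    exact Fin.ext hxy
  refine ⟨{x | v x = 0 ∧ u x = 0}, ?_, ?_⟩
  · rintro ⟨⟨c, hc⟩, x, i⟩ ⟨⟨d, hd⟩, y, j⟩ heq
    simp only at heq
    have key : ∀ (i x : ℕ) (c : G), v c = 0 → v ((β ^ i)⁻¹ * (α ^ x * c)) = -i := by
      intro i x c hc
      have := hvβ' i ((β ^ i)⁻¹ * (α ^ x * c))
      rw [mul_inv_cancel_left, hvα', hc] at this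
      exact eq_neg_of_add_eq_zero_left this.symm
    have hij : i = j := by
      refine hfin _ i j (neg_injective ?_)
      rw [← key i x c hc.1, ← key j y d hd.1, heq]
    subst hij
    have heq' := mul_left_cancel heq
    have hxy : x = y := by
      refine hfin _ x y ?_
      have := congrArg u heq'
      simpa [hu', hc.2, hd.2] using this
    subst hxy
    have := mul_left_cancel heq'
    subst this
    rfl
  · intro x
    set i := (-(v x)).val with hi
    set y := (u (β ^ i * x)).val with hy
    refine ⟨⟨⟨(α ^ y)⁻¹ * (β ^ i * x), ?_, ?_⟩, ⟨y, ZMod.val_lt _⟩, ⟨i, ZMod.val_lt _⟩⟩, ?_⟩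
    · have := hvα' y ((α ^ y)⁻¹ * (β ^ i * x))
      rw [mul_inv_cancel_left, hvβ', hi, ZMod.natCast_zmod_val, add_neg_cancel] at this
      exact this.symm
    · have := hu' y ((α ^ y)⁻¹ * (β ^ i * x))
      rw [mul_inv_cancel_left, hy, ZMod.natCast_zmod_val] at this
      simpa using this
    · simp

end Conj

section Rokhlin

variable {Y : Type*}

/-- `t` is the first time at which the forward orbit of `y` under `τ` hits `E`. -/
def FirstHit (τ : Equiv.Perm Y) (E : Finset Y) (y : Y) (t : ℕ) : Prop :=
  (τ ^ t) y ∈ E ∧ ∀ t' < t, (τ ^ t') y ∉ E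

lemma FirstHit.unique {τ : Equiv.Perm Y} {E : Finset Y} {y : Y} {t t' : ℕ}
    (h : FirstHit τ E y t) (h' : FirstHit τ E y t') : t = t' := by
  rcases lt_trichotomy t t' with hlt | rfl | hlt
  · exact absurd h.1 (h'.2 _ hlt)
  · rfl
  · exact absurd h'.1 (h.2 _ hlt)

lemma FirstHit.shift {τ : Equiv.Perm Y} {E : Finset Y} {y : Y} {t i : ℕ}
    (h : FirstHit τ E y t) (hi : i ≤ t) : FirstHit τ E ((τ ^ i) y) (t - i) := by
  refine ⟨?_, fun t' ht' => ?_⟩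
  · rw [← Equiv.Perm.mul_apply, ← pow_add, Nat.sub_add_cancel hi]
    exact h.1
  · rw [← Equiv.Perm.mul_apply, ← pow_add]
    exact h.2 _ (by omega)

variable [Fintype Y]

open Classical in
/-- The base of a Rokhlin tower of height `q`: points whose first hitting time of `E` is a
positive multiple of `q` below `T`. -/
noncomputable def rokhlinBase (τ : Equiv.Perm Y) (E : Finset Y) (q T : ℕ) : Finset Y :=
  Finset.univ.filter fun y => ∃ t, q ≤ t ∧ t < T ∧ q ∣ t ∧ FirstHit τ E y t

lemma mem_rokhlinBase {τ : Equiv.Perm Y} {E : Finset Y} {q T : ℕ} {y : Y} :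
    y ∈ rokhlinBase τ E q T ↔ ∃ t, q ≤ t ∧ t < T ∧ q ∣ t ∧ FirstHit τ E y t := by
  simp [rokhlinBase]

lemma pow_apply_notMem_rokhlinBase {τ : Equiv.Perm Y} {E : Finset Y} {q T i : ℕ} {y : Y}
    (hy : y ∈ rokhlinBase τ E q T) (hi : 0 < i) (hiq : i < q) :
    (τ ^ i) y ∉ rokhlinBase τ E q T := by
  intro h
  obtain ⟨t, hqt, -, hdvd, ht⟩ := mem_rokhlinBase.mp hy
  obtain ⟨t', -, -, hdvd', ht'⟩ := mem_rokhlinBase.mp h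
  have h1 := ht'.unique (ht.shift (hiq.le.trans hqt))
  have h2 : q ∣ i := by
    have h3 := Nat.dvd_sub hdvd hdvd'
    rwa [h1, Nat.sub_sub_self (hiq.le.trans hqt)] at h3
  exact absurd (Nat.le_of_dvd hi h2) (by omega)

lemma card_le_rokhlinBase [DecidableEq Y] (τ : Equiv.Perm Y) (E : Finset Y) {q T : ℕ} (hq : 0 < q) :
    Fintype.card Y ≤ (Finset.univ.filter fun y => ∀ t < T, (τ ^ t) y ∉ E).card +
      q * ((rokhlinBase τ E q T).card + E.card) := by
  have hsub : (Finset.univ : Finset Y) ⊆ (Finset.univ.filter fun y => ∀ t < T, (τ ^ t) y ∉ E) ∪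
      (Finset.range q).biUnion fun r =>
        (rokhlinBase τ E q T ∪ E).image ((τ ^ r).symm : Y → Y) := by
    intro y _
    by_cases hy : ∀ t < T, (τ ^ t) y ∉ E
    · exact Finset.mem_union_left _ (Finset.mem_filter.mpr ⟨Finset.mem_univ _, hy⟩)
    · refine Finset.mem_union_right _ ?_
      push Not at hy
      obtain ⟨t, htT, ht, hmin⟩ : ∃ t < T, (τ ^ t) y ∈ E ∧ ∀ t' < t, (τ ^ t') y ∉ E := by
        classical
        obtain ⟨hT, hE⟩ := Nat.find_spec hy
        refine ⟨Nat.find hy, hT, hE, fun t' ht' hE' => Nat.find_min hy ht' ⟨by omega, hE'⟩⟩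
      have hf : FirstHit τ E ((τ ^ (t % q)) y) (t - t % q) :=
        FirstHit.shift ⟨ht, hmin⟩ (Nat.mod_le t q)
      refine Finset.mem_biUnion.mpr ⟨t % q, Finset.mem_range.mpr (Nat.mod_lt t hq),
        Finset.mem_image.mpr ⟨(τ ^ (t % q)) y, ?_, by simp⟩⟩
      rcases lt_or_ge t q with htq | htq
      · refine Finset.mem_union_right _ ?_
        rw [Nat.mod_eq_of_lt htq]
        exact ht
      · refine Finset.mem_union_left _ (mem_rokhlinBase.mpr
          ⟨t - t % q, ?_, by omega, Nat.dvd_sub_mod t, hf⟩)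
        exact Nat.le_of_dvd (by have := Nat.mod_lt t hq; omega) (Nat.dvd_sub_mod t)
  refine (Finset.card_le_card hsub).trans ((Finset.card_union_le _ _).trans ?_)
  gcongr
  refine (Finset.card_biUnion_le_card_mul _ _ _ fun r _ => ?_).trans_eq (by rw [Finset.card_range])
  exact Finset.card_image_le.trans (Finset.card_union_le _ _)

end Rokhlin

section Blocks

variable {P : ℕ} [NeZero P]

/-- The set of points after which membership in `W` changes. -/
def stepBoundary (W : Finset (ZMod P)) : Finset (ZMod P) :=
  Finset.univ.filter fun z => ¬(z ∈ W ↔ z + 1 ∈ W)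

/-- The starting points of the aligned blocks of length `L` contained in `W`. -/
def blockStarts {L : ℕ} (hL : L ∣ P) (W : Finset (ZMod P)) : Finset (ZMod P) :=
  Finset.univ.filter fun c => ZMod.castHom hL (ZMod L) c = 0 ∧ ∀ l < L, c + (l : ZMod P) ∈ W

lemma eq_of_blockStarts {L : ℕ} (hL : L ∣ P) {W : Finset (ZMod P)} {c d : ZMod P} {l m : ℕ}
    (hc : c ∈ blockStarts hL W) (hd : d ∈ blockStarts hL W) (hl : l < L) (hm : m < L)
    (h : c + (l : ZMod P) = d + (m : ZMod P)) : c = d ∧ l = m := by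
  have hc' := (Finset.mem_filter.mp hc).2.1
  have hd' := (Finset.mem_filter.mp hd).2.1
  have h1 := congrArg (ZMod.castHom hL (ZMod L)) h
  rw [map_add, map_add, hc', hd', map_natCast, map_natCast, zero_add, zero_add,
    ZMod.natCast_eq_natCast_iff', Nat.mod_eq_of_lt hl, Nat.mod_eq_of_lt hm] at h1
  subst h1
  exact ⟨add_right_cancel h, rfl⟩

lemma card_le_blockStarts {L : ℕ} (hL : L ∣ P) (W : Finset (ZMod P)) :
    W.card ≤ L * ((blockStarts hL W).card + (stepBoundary W).card) := by
  have : NeZero L := ⟨fun h => NeZero.ne P (by simpa [h] using hL)⟩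
  let π := ZMod.castHom hL (ZMod L)
  let start : ZMod P → ZMod P := fun z => z - ((π z).val : ZMod P)
  have hstart : ∀ c : ZMod P, π c = 0 → ∀ l < L, start (c + (l : ZMod P)) = c := by
    intro c hc l hl
    simp only [start, map_add, hc, map_natCast, zero_add, ZMod.val_natCast, Nat.mod_eq_of_lt hl,
      add_sub_cancel_right]
  have hπ : ∀ z, π (start z) = 0 := by
    intro z
    simp only [start, map_sub, map_natCast, ZMod.natCast_zmod_val, sub_self]
  have hsub : W ⊆ (Finset.range L).biUnion fun l =>
      (blockStarts hL W ∪ (stepBoundary W).image start).image fun c => c + (l : ZMod P) := by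
    intro w hw
    refine Finset.mem_biUnion.mpr ⟨(π w).val, Finset.mem_range.mpr (ZMod.val_lt _),
      Finset.mem_image.mpr ⟨start w, ?_, sub_add_cancel _ _⟩⟩
    by_cases hall : ∀ l < L, start w + (l : ZMod P) ∈ W
    · exact Finset.mem_union_left _ (Finset.mem_filter.mpr ⟨Finset.mem_univ _, hπ w, hall⟩)
    · refine Finset.mem_union_right _ (Finset.mem_image.mpr ?_)
      by_contra! hno
      have hconst : ∀ l < L, (start w + (l : ZMod P) ∈ W ↔ start w ∈ W) := by
        intro l
        induction l with
        | zero => simp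
        | succ l ih =>
          intro hl
          rw [← ih (by omega : l < L)]
          by_contra hne
          refine hno (start w + (l : ZMod P)) (Finset.mem_filter.mpr ⟨Finset.mem_univ _, ?_⟩)
            (hstart _ (hπ w) l (by omega))
          rw [add_assoc, ← Nat.cast_succ]
          tauto
      have h0 : start w ∈ W := by
        rw [← hconst _ (ZMod.val_lt (π w))]
        simpa [start] using hw
      exact hall fun l hl => (hconst l hl).mpr h0
  refine (Finset.card_le_card hsub).trans ?_
  refine (Finset.card_biUnion_le_card_mul _ _ _ fun l _ => ?_).trans_eq (by rw [Finset.card_range])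
  refine Finset.card_image_le.trans ((Finset.card_union_le _ _).trans ?_)
  exact Nat.add_le_add_left Finset.card_image_le _

lemma card_translate_boundary_le (e a : ℕ) :
    (Finset.univ.filter fun z : ZMod P => ¬(z.val < e ↔ (z + (a : ZMod P)).val < e)).card
      ≤ 2 * a := by
  have hsub : (Finset.univ.filter fun z : ZMod P => ¬(z.val < e ↔ (z + (a : ZMod P)).val < e)) ⊆
      (Finset.univ.filter fun z : ZMod P => z.val ∈ Finset.Ico (e - a) e) ∪
      (Finset.univ.filter fun z : ZMod P => (z + (a : ZMod P)).val ∈ Finset.range a) := by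
    intro z hz
    simp only [Finset.mem_filter, Finset.mem_univ, true_and, Finset.mem_union, Finset.mem_Ico,
      Finset.mem_range] at hz ⊢
    have hval : (z + (a : ZMod P)).val = (z.val + a) % P := by
      rw [ZMod.val_add, ZMod.val_natCast, Nat.add_mod_mod]
    have hlt := ZMod.val_lt z
    have hle := Nat.mod_le (z.val + a) P
    rcases lt_or_ge (z.val + a) P with h | h
    · rw [Nat.mod_eq_of_lt h] at hval
      omega
    · have h2 : (z.val + a) % P ≤ z.val + a - P := by
        rw [Nat.mod_eq_sub_mod h]
        exact Nat.mod_le _ _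
      omega
  refine (Finset.card_le_card hsub).trans ((Finset.card_union_le _ _).trans ?_)
  have h1 : (Finset.univ.filter fun z : ZMod P => z.val ∈ Finset.Ico (e - a) e).card ≤ a := by
    refine (Finset.card_le_card_of_injOn (t := Finset.Ico (e - a) e) ZMod.val
      (fun z hz => (Finset.mem_filter.mp hz).2) (ZMod.val_injective P).injOn).trans ?_
    rw [Nat.card_Ico]
    omega
  have h2 : (Finset.univ.filter fun z : ZMod P =>
      (z + (a : ZMod P)).val ∈ Finset.range a).card ≤ a := by
    refine (Finset.card_le_card_of_injOn (t := Finset.range a) (fun z => (z + (a : ZMod P)).val)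
      (fun z hz => (Finset.mem_filter.mp hz).2) ?_).trans (Finset.card_range a).le
    exact ((ZMod.val_injective P).comp (add_left_injective _)).injOn
  omega

end Blocks

section Multiplication

/-- Points of `[0, P)` whose first `K` base-`B` digits (relative to `P`) are all nonzero. -/
lemma card_no_hit_le {B P : ℕ} (hB : 0 < B) (hP : 0 < P) (K : ℕ) :
    ((Finset.range P).filter fun y => ∀ t < K, ¬ B * ((B ^ t * y) % P) < P).card ≤
      (B - 1) ^ K * (P / B ^ K + 1) := by
  have hdig : ∀ K : ℕ, ((Finset.range (B ^ K)).filter fun g =>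
      ∀ j < K, (g / B ^ j) % B ≠ 0).card ≤ (B - 1) ^ K := by
    intro K
    induction K with
    | zero => exact (Finset.card_filter_le _ _).trans (by simp)
    | succ K ih =>
      refine (Finset.card_le_card_of_injOn (t := ((Finset.range (B ^ K)).filter fun g =>
        ∀ j < K, (g / B ^ j) % B ≠ 0) ×ˢ Finset.Ico 1 B) (fun g => (g / B, g % B))
          (fun g hg => ?_) ?_).trans ?_
      · simp only [Finset.coe_filter, Finset.mem_range, Set.mem_ofPred_eq] at hg
        obtain ⟨hg1, hg2⟩ := hg
        simp only [Finset.coe_product, Set.mem_prod, Finset.coe_filter, Finset.mem_range,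
          Set.mem_ofPred_eq, Finset.coe_Ico, Set.mem_Ico]
        refine ⟨⟨?_, fun j hj => ?_⟩, ?_, Nat.mod_lt _ hB⟩
        · rw [Nat.div_lt_iff_lt_mul hB, ← pow_succ]
          exact hg1
        · rw [Nat.div_div_eq_div_mul, ← pow_succ']
          exact hg2 _ (by omega)
        · have := hg2 0 (by omega)
          rw [pow_zero, Nat.div_one] at this
          omega
      · intro g _ g' _ h
        simp only [Prod.mk.injEq] at h
        rw [← Nat.div_add_mod g B, h.1, h.2, Nat.div_add_mod]
      · rw [Finset.card_product, Nat.card_Ico, pow_succ]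
        gcongr
  refine (Finset.card_le_mul_card_image (f := fun y => B ^ K * y / P) _ (P / B ^ K + 1)
    (fun g _ => ?_)).trans ?_
  · have hBK : 0 < B ^ K := pow_pos hB K
    generalize hS : (Finset.filter (fun y => B ^ K * y / P = g) _) = S
    rcases S.eq_empty_or_nonempty with rfl | hne
    · simp
    have hmem : ∀ y ∈ S, g * P ≤ B ^ K * y ∧ B ^ K * y < (g + 1) * P := fun y hy => by
      rw [← hS] at hy
      exact ⟨(Nat.le_div_iff_mul_le hP).mp (Finset.mem_filter.mp hy).2.ge,
        (Nat.div_lt_iff_lt_mul hP).mp (by have := (Finset.mem_filter.mp hy).2; omega)⟩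
    have hsub : S ⊆ Finset.Icc (S.min' hne) (S.min' hne + P / B ^ K) := by
      intro y hy
      refine Finset.mem_Icc.mpr ⟨S.min'_le y hy, ?_⟩
      have h1 := (hmem y hy).2
      have h2 := (hmem _ (S.min'_mem hne)).1
      suffices y - S.min' hne ≤ P / B ^ K by omega
      rw [Nat.le_div_iff_mul_le hBK, Nat.sub_mul, mul_comm y, mul_comm _ (B ^ K)]
      rw [add_mul, one_mul] at h1
      omega
    refine (Finset.card_le_card hsub).trans ?_
    rw [Nat.card_Icc]
    generalize P / B ^ K = d
    omega
  · rw [mul_comm]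
    gcongr
    refine (Finset.card_le_card ?_).trans (hdig K)
    intro g hg
    obtain ⟨y, hy, rfl⟩ := Finset.mem_image.mp hg
    simp only [Finset.mem_filter, Finset.mem_range] at hy ⊢
    obtain ⟨hyP, hy⟩ := hy
    refine ⟨?_, fun j hj => ?_⟩
    · rw [Nat.div_lt_iff_lt_mul hP]
      exact Nat.mul_lt_mul_of_pos_left hyP (pow_pos hB K)
    · obtain ⟨t, rfl⟩ : ∃ t, K = t + 1 + j := ⟨K - 1 - j, by omega⟩
      have h1 : B ^ (t + 1 + j) * y / P / B ^ j = B ^ (t + 1) * y / P := by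
        rw [Nat.div_right_comm, pow_add, mul_right_comm, Nat.mul_div_cancel _ (pow_pos hB j)]
      rw [h1]
      have h2 := hy t (by omega)
      intro h3
      apply h2
      have h4 : B ^ (t + 1) * y = P * (B * (B ^ t * y / P)) + B * ((B ^ t * y) % P) := by
        conv_lhs => rw [pow_succ', mul_assoc, ← Nat.div_add_mod (B ^ t * y) P]
        ring
      rw [h4, Nat.mul_add_div hP, Nat.mul_add_mod] at h3
      have h5 : B * ((B ^ t * y) % P) / P < B := by
        rw [Nat.div_lt_iff_lt_mul hP]
        exact Nat.mul_lt_mul_of_pos_left (Nat.mod_lt _ hP) hB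
      rw [Nat.mod_eq_of_lt h5] at h3
      exact (Nat.div_eq_zero_iff_lt hP).mp h3


lemma mulLeft_pow_apply {P : ℕ} (u : (ZMod P)ˣ) (t : ℕ) (y : ZMod P) :
    (u.mulLeft ^ t) y = (u : ZMod P) ^ t * y := by
  induction t with
  | zero => simp
  | succ t ih => rw [pow_succ', Equiv.Perm.mul_apply, ih, Units.mulLeft_apply, pow_succ', mul_assoc]

variable {P : ℕ} [NeZero P]

lemma card_stepBoundary_rokhlinBase_le {k : ℕ} (u : (ZMod P)ˣ) (hu : (u : ZMod P) = k)
    (e q T : ℕ) :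
    (stepBoundary (rokhlinBase u.mulLeft (Finset.univ.filter fun z => z.val < e) q T)).card ≤
      ∑ t ∈ Finset.range T, 2 * k ^ t := by
  set E : Finset (ZMod P) := Finset.univ.filter fun z => z.val < e with hE
  have hsub : stepBoundary (rokhlinBase u.mulLeft E q T) ⊆ (Finset.range T).biUnion fun t =>
      (Finset.univ.filter fun z : ZMod P =>
        ¬(z.val < e ↔ (z + ((k ^ t : ℕ) : ZMod P)).val < e)).image
          (u.mulLeft ^ t).symm := by
    intro z hz
    by_contra hno
    have hiff : ∀ t < T, ((u.mulLeft ^ t) z ∈ E ↔ (u.mulLeft ^ t) (z + 1) ∈ E) := by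
      intro t ht
      by_contra hne
      refine hno (Finset.mem_biUnion.mpr ⟨t, Finset.mem_range.mpr ht, Finset.mem_image.mpr
        ⟨(u.mulLeft ^ t) z, Finset.mem_filter.mpr ⟨Finset.mem_univ _, ?_⟩, by simp⟩⟩)
      simpa [hE, mulLeft_pow_apply, mul_add, hu] using hne
    refine (Finset.mem_filter.mp hz).2 ?_
    have hfirst : ∀ t < T, (FirstHit u.mulLeft E z t ↔ FirstHit u.mulLeft E (z + 1) t) :=
      fun t ht => and_congr (hiff t ht) (forall₂_congr fun t' ht' =>
        not_congr (hiff t' (ht'.trans ht)))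
    simp only [mem_rokhlinBase]
    exact exists_congr fun t => and_congr_right fun _ => and_congr_right fun ht =>
      and_congr_right fun _ => hfirst t ht
  refine (Finset.card_le_card hsub).trans (Finset.card_biUnion_le.trans ?_)
  gcongr with t _
  exact Finset.card_image_le.trans (card_translate_boundary_le e (k ^ t))

lemma card_no_hit_zmod_le {k : ℕ} (hk : 0 < k) (u : (ZMod P)ˣ) (hu : (u : ZMod P) = k)
    (r K T : ℕ) (hT : r * K ≤ T) (hr : 0 < r) :
    (Finset.univ.filter fun y : ZMod P => ∀ t < T, (u.mulLeft ^ t) y ∉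
      Finset.univ.filter fun z : ZMod P => k ^ r * z.val < P).card ≤
      (k ^ r - 1) ^ K * (P / (k ^ r) ^ K + 1) := by
  refine (Finset.card_le_card_of_injOn ZMod.val (fun y hy => ?_)
    (ZMod.val_injective P).injOn).trans (card_no_hit_le (pow_pos hk r) (NeZero.pos P) K)
  have hy' := (Finset.mem_filter.mp hy).2
  refine Finset.mem_coe.mpr (Finset.mem_filter.mpr
    ⟨Finset.mem_range.mpr (ZMod.val_lt y), fun t ht => ?_⟩)
  have h1 := hy' (r * t) ((Nat.mul_lt_mul_of_pos_left ht hr).trans_le hT)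
  have h2 : ((u : ZMod P) ^ (r * t) * y).val = ((k ^ r) ^ t * y.val) % P := by
    rw [← ZMod.val_natCast, Nat.cast_mul, ZMod.natCast_zmod_val, hu, ← pow_mul, Nat.cast_pow]
  simpa [mulLeft_pow_apply, h2] using h1

/-- Approximate tiling of `ZMod P` by Følner sets of the affine action. -/
lemma exists_zmod_tiling {k q L r K : ℕ} (hk : 0 < k) (hq : 0 < q) (hr : 0 < r) (hL : L ∣ P)
    (u : (ZMod P)ˣ) (hu : (u : ZMod P) = k) :
    ∃ C : Finset (ZMod P), (∀ c ∈ C, ∀ d ∈ C, ∀ l < L, ∀ m < L, ∀ i < q, ∀ j < q,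
      (u⁻¹ : (ZMod P)ˣ) ^ i * (c + (l : ZMod P)) = (u⁻¹ : (ZMod P)ˣ) ^ j * (d + (m : ZMod P)) →
        c = d ∧ l = m ∧ i = j) ∧
      P ≤ q * (L * (C.card + ∑ t ∈ Finset.range (q * r * K), 2 * k ^ t) + (P / k ^ r + 1)) +
        (k ^ r - 1) ^ K * (P / (k ^ r) ^ K + 1) := by
  obtain ⟨e, he⟩ : ∃ e, ∀ z : ZMod P, k ^ r * z.val < P ↔ z.val < e := by
    refine ⟨(P + k ^ r - 1) / k ^ r, fun z => ?_⟩
    have hB := pow_pos hk r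
    rw [Nat.lt_iff_add_one_le, Nat.lt_iff_add_one_le, Nat.le_div_iff_mul_le hB, add_mul, mul_comm]
    omega
  set E : Finset (ZMod P) := Finset.univ.filter fun z => k ^ r * z.val < P with hE
  have hE' : E = Finset.univ.filter fun z => z.val < e := by simp only [hE, he]
  set W := rokhlinBase u.mulLeft E q (q * r * K) with hW
  have hne : ∀ x ∈ W, ∀ y ∈ W, ∀ i j, i < j → j < q →
      (u⁻¹ : (ZMod P)ˣ) ^ i * x ≠ ((u⁻¹ : (ZMod P)ˣ) : ZMod P) ^ j * y := by
    intro x hx y hy i j hij hj h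
    refine pow_apply_notMem_rokhlinBase hx (Nat.sub_pos_of_lt hij) (by omega) ?_
    rw [← hW, mulLeft_pow_apply]
    convert hy using 1
    have h1 := congrArg (fun z => (u : ZMod P) ^ j * z) h
    simp only [← mul_assoc, ← Units.val_pow_eq_pow_val, ← Units.val_mul] at h1 ⊢
    rw [inv_pow, inv_pow, mul_inv_cancel, ← pow_sub _ hij.le, Units.val_one, one_mul] at h1
    exact h1
  refine ⟨blockStarts hL W, ?_, ?_⟩
  · intro c hc d hd l hl m hm i hi j hj h
    have hx := (Finset.mem_filter.mp hc).2.2 l hl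
    have hy := (Finset.mem_filter.mp hd).2.2 m hm
    rcases lt_trichotomy i j with hij | rfl | hij
    · exact absurd h (hne _ hx _ hy i j hij hj)
    · rw [← Units.val_pow_eq_pow_val, Units.mul_right_inj] at h
      obtain ⟨h1, h2⟩ := eq_of_blockStarts hL hc hd hl hm h
      exact ⟨h1, h2, rfl⟩
    · exact absurd h.symm (hne _ hy _ hx j i hij hi)
  · have h1 := card_le_rokhlinBase u.mulLeft E (T := q * r * K) hq
    rw [ZMod.card] at h1
    have h2 := card_no_hit_zmod_le hk u hu r K (q * r * K)
      (by rw [mul_assoc]; exact Nat.le_mul_of_pos_left _ hq) hr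
    have h3 := card_le_blockStarts hL W
    have h4 : (stepBoundary W).card ≤ ∑ t ∈ Finset.range (q * r * K), 2 * k ^ t := by
      rw [hW, hE']
      exact card_stepBoundary_rokhlinBase_le u hu e q _
    have h5 : E.card ≤ P / k ^ r + 1 := by
      refine (Finset.card_le_card_of_injOn (t := Finset.range (P / k ^ r + 1)) ZMod.val
        (fun y hy => ?_) (ZMod.val_injective P).injOn).trans (Finset.card_range _).le
      have hy' := (Finset.mem_filter.mp hy).2
      simp only [Finset.coe_range, Set.mem_Iio, Nat.lt_succ_iff]
      rw [Nat.le_div_iff_mul_le (pow_pos hk r), mul_comm]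
      exact hy'.le
    calc P ≤ _ := h1
      _ ≤ _ := Nat.add_le_add_right h2 _
      _ = _ := Nat.add_comm _ _
      _ ≤ _ := by
        gcongr
        exact h3.trans (by gcongr)

lemma exists_zmod_tiling_of_le {p k : ℕ} (hp : p.Prime) (hk : 2 ≤ k) (s l : ℕ) {δ : ℝ}
    (hδ : 0 < δ) : ∃ M₀ : ℕ, ∀ M ≥ M₀, l ≤ M → ∀ u : (ZMod (p ^ M))ˣ, (u : ZMod (p ^ M)) = k →
      ∃ C : Finset (ZMod (p ^ M)), (∀ c ∈ C, ∀ d ∈ C, ∀ l' < p ^ l, ∀ m < p ^ l, ∀ i < p ^ s,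
        ∀ j < p ^ s, (u⁻¹ : (ZMod (p ^ M))ˣ) ^ i * (c + (l' : ZMod (p ^ M))) =
          (u⁻¹ : (ZMod (p ^ M))ˣ) ^ j * (d + (m : ZMod (p ^ M))) → c = d ∧ l' = m ∧ i = j) ∧
      (1 - δ) * (p ^ M : ℝ) ≤ C.card * p ^ l * p ^ s := by
  have hk1 : (1 : ℝ) < k := by exact_mod_cast hk
  have hp1 : (1 : ℝ) < p := by exact_mod_cast hp.one_lt
  obtain ⟨r, hr⟩ := pow_unbounded_of_one_lt (4 * p ^ s / δ : ℝ) hk1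
  have hB : (4 * p ^ s / δ : ℝ) < k ^ (r + 1) :=
    hr.trans (pow_lt_pow_right₀ hk1 (Nat.lt_succ_self r))
  set B : ℕ := k ^ (r + 1) with hBdef
  have hB0 : 0 < B := pow_pos (by omega) _
  have hB0' : (0 : ℝ) < B := by exact_mod_cast hB0
  obtain ⟨K, hK⟩ := exists_pow_lt_of_lt_one (show 0 < δ / 4 by positivity)
    (show ((B - 1) / B : ℝ) < 1 by rw [div_lt_one hB0']; linarith)
  set S : ℕ := ∑ t ∈ Finset.range (p ^ s * (r + 1) * K), 2 * k ^ t with hS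
  obtain ⟨M₀, hM₀⟩ := pow_unbounded_of_one_lt
    ((p ^ s * (p ^ l * S + 1) + (B - 1) ^ K) / (δ / 2) : ℝ) hp1
  refine ⟨M₀, fun M hM hl u hu => ?_⟩
  have : NeZero (p ^ M) := ⟨(pow_pos hp.pos M).ne'⟩
  obtain ⟨C, hC, hcard⟩ := exists_zmod_tiling (q := p ^ s) (r := r + 1) (K := K) (by omega)
    (pow_pos hp.pos s) (Nat.succ_pos r) (pow_dvd_pow p hl) u hu
  refine ⟨C, hC, ?_⟩
  rw [← hS, ← hBdef] at hcard
  have hcard' : (p ^ M : ℝ) ≤ p ^ s * (p ^ l * (C.card + S) + (((p ^ M / B : ℕ) : ℝ) + 1)) +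
      (B - 1) ^ K * (((p ^ M / B ^ K : ℕ) : ℝ) + 1) := by
    have h : ((p ^ M : ℕ) : ℝ) ≤ _ := Nat.cast_le.mpr hcard
    push_cast [Nat.cast_sub (show 1 ≤ B from hB0)] at h
    exact h
  have hM' : ((p ^ s * (p ^ l * S + 1) + (B - 1) ^ K) / (δ / 2) : ℝ) < p ^ M :=
    hM₀.trans_le (pow_le_pow_right₀ hp1.le hM)
  rw [div_lt_iff₀ (by positivity)] at hM'
  have h1 : (p ^ s * ((p ^ M / B : ℕ) : ℝ) : ℝ) ≤ δ / 4 * p ^ M := by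
    have h2 : ((p ^ M / B : ℕ) : ℝ) ≤ (p ^ M : ℝ) / B := by exact_mod_cast Nat.cast_div_le
    have h3 : (p ^ s : ℝ) ≤ δ / 4 * B := by
      rw [div_lt_iff₀ hδ] at hB
      rw [hBdef]
      push_cast
      linarith
    calc (p ^ s * ((p ^ M / B : ℕ) : ℝ) : ℝ) ≤ (δ / 4 * B) * ((p ^ M : ℝ) / B) := by gcongr
      _ = _ := by field_simp
  have h2 : ((B - 1) ^ K * ((p ^ M / B ^ K : ℕ) : ℝ) : ℝ) ≤ δ / 4 * p ^ M := by
    have h2 : ((p ^ M / B ^ K : ℕ) : ℝ) ≤ (p ^ M : ℝ) / B ^ K := by exact_mod_cast Nat.cast_div_le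
    have h3 : (0 : ℝ) ≤ B - 1 := by
      rw [sub_nonneg]
      exact_mod_cast hB0
    calc ((B - 1) ^ K * ((p ^ M / B ^ K : ℕ) : ℝ) : ℝ)
        ≤ (B - 1) ^ K * ((p ^ M : ℝ) / B ^ K) := by gcongr
      _ = ((B - 1) / B : ℝ) ^ K * p ^ M := by
        rw [div_pow]
        ring
      _ ≤ _ := by gcongr
  nlinarith

end Multiplication

lemma exists_equiv_extending {I X Y : Type*} [Finite X] [Finite Y] (hXY : Nat.card X = Nat.card Y)
    {j : I → X} {e : I → Y} (hj : Function.Injective j) (he : Function.Injective e) :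
    ∃ φ : X ≃ Y, ∀ t, φ (j t) = e t := by
  classical
  have := Fintype.ofFinite X
  have := Fintype.ofFinite Y
  rw [Nat.card_eq_fintype_card, Nat.card_eq_fintype_card] at hXY
  let φ₀ : X ≃ Y := Fintype.equivOfCardEq hXY
  have he' : Function.Injective (φ₀.symm ∘ e) := φ₀.symm.injective.comp he
  let π : {x // x ∈ Set.range j} ≃ {x // x ∈ Set.range (φ₀.symm ∘ e)} :=
    (Equiv.ofInjective j hj).symm.trans (Equiv.ofInjective _ he')
  refine ⟨π.extendSubtype.trans φ₀, fun t => ?_⟩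
  rw [Equiv.trans_apply, Equiv.extendSubtype_apply_of_mem π (j t) ⟨t, rfl⟩]
  have h1 : (Equiv.ofInjective j hj).symm ⟨j t, t, rfl⟩ = t :=
    (Equiv.symm_apply_eq _).mpr rfl
  simp only [π, Equiv.trans_apply, h1, Equiv.ofInjective_apply, Function.comp_apply,
    Equiv.apply_symm_apply]

/-- Transporting a twisted symmetry of a tiled group to `ZMod P` along a partial matching of
tiles. -/
lemma card_good_ge {X : Type*} [Group X] [Finite X] {P k L q : ℕ} [NeZero P]
    (hXP : Nat.card X = P) {α β : X} (h : β * α * β⁻¹ = α ^ k) (hk : 0 < k) {σ : X ≃ X}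
    (hσ : ∀ x, σ (α * x) = β * σ x) (u : (ZMod P)ˣ) (hu : (u : ZMod P) = k) {I : Type*} [Finite I]
    {a : I → X} {c : I → ZMod P}
    (ha : Function.Injective fun t : I × Fin L × Fin q =>
      (β ^ (t.2.2 : ℕ))⁻¹ * (α ^ (t.2.1 : ℕ) * a t.1))
    (hc : Function.Injective fun t : I × Fin L × Fin q =>
      (u⁻¹ : (ZMod P)ˣ) ^ (t.2.2 : ℕ) * (c t.1 + ((t.2.1 : ℕ) : ZMod P))) :
    ∃ φ : X ≃ ZMod P,
      Nat.card I * ((L - k ^ q) * q) + Nat.card I * (L * (q - 1)) ≤ P + Nat.card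
        {y : ZMod P // φ (σ (φ.symm (y + 1))) = k * φ (σ (φ.symm y))} := by
  classical
  have hI := Fintype.ofFinite I
  obtain ⟨φ, hφ⟩ := exists_equiv_extending (by rw [hXP, Nat.card_zmod]) ha hc
  refine ⟨φ, ?_⟩
  let j : I → ℕ → ℕ → X := fun x l i => (β ^ i)⁻¹ * (α ^ l * a x)
  let e : I → ℕ → ℕ → ZMod P := fun x l i =>
    ((u⁻¹ : (ZMod P)ˣ) : ZMod P) ^ i * (c x + (l : ZMod P))
  have hφ' : ∀ x l i, l < L → i < q → φ (j x l i) = e x l i := fun x l i hl hi =>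
    hφ (x, ⟨l, hl⟩, ⟨i, hi⟩)
  have hj : ∀ x l i y m n, l < L → i < q → m < L → n < q → j x l i = j y m n →
      x = y ∧ l = m ∧ i = n := by
    intro x l i y m n hl hi hm hn heq
    have := @ha (x, ⟨l, hl⟩, ⟨i, hi⟩) (y, ⟨m, hm⟩, ⟨n, hn⟩) heq
    simpa using this
  have hjα : ∀ x l i, α * j x l i = j x (l + k ^ i) i := by
    intro x l i
    simp only [j]
    rw [add_comm, pow_add, ← pow_conj_eq h i]
    group
  have hjβ : ∀ x l i, β * j x l (i + 1) = j x l i := by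
    intro x l i
    simp only [j]
    rw [pow_succ]
    group
  have huk : ∀ i : ℕ, ((u⁻¹ : (ZMod P)ˣ) : ZMod P) ^ i * ((k ^ i : ℕ) : ZMod P) = 1 := by
    intro i
    rw [Nat.cast_pow, ← hu, ← mul_pow, Units.inv_mul, one_pow]
  have heα : ∀ x l i, e x l i + 1 = e x (l + k ^ i) i := by
    intro x l i
    simp only [e]
    rw [Nat.cast_add, ← add_assoc, mul_add _ _ ((k ^ i : ℕ) : ZMod P), huk]
  have heβ : ∀ x l i, (k : ZMod P) * e x l (i + 1) = e x l i := by
    intro x l i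
    simp only [e]
    rw [pow_succ', ← mul_assoc, ← mul_assoc, ← hu, Units.mul_inv, one_mul]
  let A₁ : Finset (ZMod P) := Finset.univ.image fun t : I × Fin (L - k ^ q) × Fin q =>
    φ (j t.1 t.2.1 t.2.2)
  let A₂ : Finset (ZMod P) := Finset.univ.image fun t : I × Fin L × Fin (q - 1) =>
    φ (σ.symm (j t.1 t.2.1 (t.2.2 + 1)))
  have hA₁ : A₁.card = Nat.card I * ((L - k ^ q) * q) := by
    rw [Finset.card_image_of_injective]
    · simp [Finset.card_univ, Nat.card_eq_fintype_card]
    · rintro ⟨x, l, i⟩ ⟨y, m, n⟩ heq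
      have := hj x l i y m n (by omega) i.2 (by omega) n.2 (φ.injective heq)
      simpa [Fin.ext_iff] using this
  have hA₂ : A₂.card = Nat.card I * (L * (q - 1)) := by
    rw [Finset.card_image_of_injective]
    · simp [Finset.card_univ, Nat.card_eq_fintype_card]
    · rintro ⟨x, l, i⟩ ⟨y, m, n⟩ heq
      have := hj x l (i + 1) y m (n + 1) l.2 (by omega) m.2 (by omega)
        (σ.symm.injective (φ.injective heq))
      simpa [Fin.ext_iff] using this
  have hgood : A₁ ∩ A₂ ⊆ Finset.univ.filter fun y : ZMod P =>
      φ (σ (φ.symm (y + 1))) = k * φ (σ (φ.symm y)) := by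
    intro y hy
    obtain ⟨⟨x, l, i⟩, -, hy₁⟩ := Finset.mem_image.mp (Finset.mem_inter.mp hy).1
    obtain ⟨⟨z, m, n⟩, -, hy₂⟩ := Finset.mem_image.mp (Finset.mem_inter.mp hy).2
    simp only at hy₁ hy₂
    have hl := l.2
    have hn := n.2
    have hki : k ^ (i : ℕ) ≤ k ^ q := Nat.pow_le_pow_right hk i.2.le
    have h1 : y + 1 = φ (α * φ.symm y) := by
      rw [← hy₁, Equiv.symm_apply_apply, hjα, hφ' _ _ _ (by omega) i.2, heα,
        hφ' _ _ _ (by omega) i.2]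
    have h2 : σ (φ.symm y) = j z m (n + 1) := by
      rw [← hy₂, Equiv.symm_apply_apply, Equiv.apply_symm_apply]
    refine Finset.mem_filter.mpr ⟨Finset.mem_univ _, ?_⟩
    rw [h1, Equiv.symm_apply_apply, hσ, h2, hjβ, hφ' _ _ _ m.2 (by omega),
      hφ' _ _ _ m.2 (by omega), heβ]
  rw [← hA₁, ← hA₂, ← Finset.card_union_add_card_inter, Nat.card_eq_fintype_card,
    Fintype.card_subtype]
  refine Nat.add_le_add ((Finset.card_le_univ _).trans (ZMod.card P).le) (Finset.card_le_card hgood)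

/-- Let `p` be a prime and `k ≥ 2` an integer with `p ∣ k - 1`. Then for every
real `ε > 0` there exist `n ≥ 1` and a bijection `f : ZMod (p^n) → ZMod (p^n)` such that
`f (x + 1) = k * f x` for at least `(1 - ε) * p^n` elements `x`, and `f (f (f (f x))) = x`
for all `x`. -/
theorem higman_almost_exponential_bijection
    (p k : ℕ) (hp : Nat.Prime p) (hk : 2 ≤ k) (hdvd : p ∣ k - 1)
    (ε : ℝ) (hε : 0 < ε) :
    ∃ n : ℕ, 1 ≤ n ∧ ∃ f : ZMod (p ^ n) ≃ ZMod (p ^ n),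
      (1 - ε) * (p ^ n : ℝ) ≤
        (Nat.card {x : ZMod (p ^ n) // f (x + 1) = (k : ZMod (p ^ n)) * f x} : ℝ) ∧
      ∀ x : ZMod (p ^ n), f (f (f (f x))) = x := by
  have hp1 : (1 : ℝ) < p := by exact_mod_cast hp.one_lt
  obtain ⟨δ, hδ, rfl⟩ : ∃ δ : ℝ, 0 < δ ∧ ε = 4 * δ := ⟨ε / 4, by positivity, by ring⟩
  obtain ⟨s, hs⟩ := pow_unbounded_of_one_lt (1 / δ) hp1
  obtain ⟨l, hl⟩ := pow_unbounded_of_one_lt ((k : ℝ) ^ p ^ s / δ) hp1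
  rw [div_lt_iff₀ hδ] at hs hl
  obtain ⟨M₀, hM₀⟩ := exists_zmod_tiling_of_le hp hk s l hδ
  obtain ⟨n₀, hn₀⟩ := pow_unbounded_of_one_lt (k ^ p ^ s) hp.one_lt
  set n := n₀ + M₀ + l + 1 with hn
  have hkn : k ^ p ^ s < p ^ n := hn₀.trans_le (Nat.pow_le_pow_right hp.pos (by omega))
  obtain ⟨Q, _, _, b, hQ, hb, hord⟩ := exists_higman_pGroup hp (by omega) hdvd n
  have hX : IsPGroup p (Fin 4 → Q) := by
    choose m hm using hQ
    intro x
    refine ⟨∑ i, m (x i), funext fun i => ?_⟩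
    obtain ⟨d, hd⟩ := pow_dvd_pow p (Finset.single_le_sum (f := fun i => m (x i))
      (fun _ _ => Nat.zero_le _) (Finset.mem_univ i))
    rw [Pi.pow_apply, hd, pow_mul, hm, one_pow, Pi.one_apply]
  have hrel : (fun i => b (i + 1)) * b * (fun i => b (i + 1))⁻¹ = b ^ k := funext hb
  have hord' : p ^ n ∣ orderOf b :=
    hord.trans (orderOf_map_dvd (Pi.evalMonoidHom (fun _ : Fin 4 => Q) 0) b)
  have := Fact.mk hp
  obtain ⟨M, hM⟩ := IsPGroup.iff_card.mp hX
  have hnM : n ≤ M := by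
    have h1 : p ^ n ∣ p ^ M := hM ▸ hord'.trans (orderOf_dvd_natCard b)
    exact (Nat.pow_dvd_pow_iff_le_right hp.one_lt).mp h1
  have : NeZero (p ^ M) := ⟨(pow_pos hp.pos M).ne'⟩
  have hcop : k.Coprime (p ^ M) := by
    refine Nat.Coprime.pow_right M (Nat.Coprime.symm ((Nat.Prime.coprime_iff_not_dvd hp).mpr
      fun hpk => ?_))
    have := Nat.dvd_sub hpk hdvd
    rw [Nat.sub_sub_self (by omega)] at this
    exact hp.one_lt.ne' (Nat.dvd_one.mp this)
  obtain ⟨C, hC⟩ := exists_group_tiling hp hX hrel hk hdvd hord' hkn (show l ≤ n by omega)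
  obtain ⟨D, hD, hDcard⟩ := hM₀ M (by omega) (by omega) (ZMod.unitOfCoprime k hcop) rfl
  set u := ZMod.unitOfCoprime k hcop
  have hDinj : Function.Injective fun t : D × Fin (p ^ l) × Fin (p ^ s) =>
      ((u⁻¹ : (ZMod (p ^ M))ˣ) : ZMod (p ^ M)) ^ (t.2.2 : ℕ) *
        ((t.1 : ZMod (p ^ M)) + ((t.2.1 : ℕ) : ZMod (p ^ M))) := by
    rintro ⟨c, x, i⟩ ⟨d, y, j⟩ heq
    obtain ⟨h1, h2, h3⟩ := hD c c.2 d d.2 x x.2 y y.2 i i.2 j j.2 heq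
    rw [Subtype.ext h1, Fin.ext h2, Fin.ext h3]
  have hDle : D.card * (p ^ l * p ^ s) ≤ p ^ M := by
    have := Nat.card_le_card_of_injective _ hDinj
    simpa [Nat.card_prod] using this
  have hCeq : Nat.card C * (p ^ l * p ^ s) = p ^ M := by
    have := Nat.card_eq_of_bijective _ hC
    rwa [Nat.card_prod, Nat.card_prod, Nat.card_fin, Nat.card_fin, hM] at this
  have hDC : Nat.card D ≤ Nat.card C := by
    rw [Nat.card_eq_fintype_card, Fintype.card_coe]
    refine Nat.le_of_mul_le_mul_right (hDle.trans hCeq.ge) ?_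
    exact mul_pos (pow_pos hp.pos l) (pow_pos hp.pos s)
  obtain ⟨ι⟩ : Nonempty (D ↪ C) := by
    have := Fintype.ofFinite C
    rw [Nat.card_eq_fintype_card, Nat.card_eq_fintype_card] at hDC
    exact Function.Embedding.nonempty_of_card_le hDC
  let σ : (Fin 4 → Q) ≃ (Fin 4 → Q) := (Equiv.subRight (1 : Fin 4)).arrowCongr (Equiv.refl Q)
  have hσapply : ∀ x i, σ x i = x (i + 1) := fun x i => by simp [σ]
  obtain ⟨φ, hφ⟩ := card_good_ge hM hrel (by omega) (σ := σ)
    (fun x => funext fun i => by simp only [hσapply, Pi.mul_apply]) u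
    (ZMod.coe_unitOfCoprime k hcop) (I := D) (a := fun x => (ι x : Fin 4 → Q)) (c := fun x => x)
    (L := p ^ l) (q := p ^ s)
    (hC.injective.comp (Function.Injective.prodMap ι.injective Function.injective_id)) hDinj
  refine ⟨M, by omega, (φ.symm.trans σ).trans φ, ?_, fun x => ?_⟩
  · simp only [Equiv.trans_apply]
    generalize Nat.card {y : ZMod (p ^ M) // φ (σ (φ.symm (y + 1))) =
      (k : ZMod (p ^ M)) * φ (σ (φ.symm y))} = g at hφ ⊢
    rw [Nat.card_eq_fintype_card, Fintype.card_coe] at hφ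
    have h1 : ((D.card : ℝ) * ((p ^ l - k ^ p ^ s) * p ^ s) + D.card * (p ^ l * (p ^ s - 1))) ≤
        p ^ M + g := by
      have h2 : (((_ : ℕ)) : ℝ) ≤ _ := Nat.cast_le.mpr hφ
      have h3 : ((p ^ l : ℕ) : ℝ) - ((k ^ p ^ s : ℕ) : ℝ) ≤ ((p ^ l - k ^ p ^ s : ℕ) : ℝ) := by
        rw [sub_le_iff_le_add]
        exact_mod_cast le_tsub_add
      push_cast [Nat.cast_sub (show 1 ≤ p ^ s from pow_pos hp.pos s)] at h2 h3
      refine le_trans ?_ h2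
      gcongr
    have h4 : (D.card * (p ^ l * p ^ s) : ℝ) ≤ p ^ M := by exact_mod_cast hDle
    have h5 : (D.card * (k ^ p ^ s * p ^ s) : ℝ) ≤ δ * p ^ M := by
      calc (D.card * (k ^ p ^ s * p ^ s) : ℝ) ≤ D.card * ((p ^ l * δ) * p ^ s) := by gcongr
        _ = δ * (D.card * (p ^ l * p ^ s)) := by ring
        _ ≤ _ := by gcongr
    have h6 : (D.card * p ^ l : ℝ) ≤ δ * p ^ M := by
      calc (D.card * p ^ l : ℝ) = D.card * p ^ l * 1 := by ring
        _ ≤ D.card * p ^ l * (p ^ s * δ) := by gcongr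
        _ = δ * (D.card * (p ^ l * p ^ s)) := by ring
        _ ≤ _ := by gcongr
    linarith
  · simp only [Equiv.trans_apply, Equiv.symm_apply_apply]
    rw [← Equiv.eq_symm_apply]
    funext i
    simp only [hσapply, add_assoc]
    have h4 : ∀ i : Fin 4, i + (1 + (1 + (1 + 1))) = i := by decide
    rw [h4]
end

section
/- With p, n, k and the ideal I = I(g_0, g_1, g_2, g_3) as in the context, the images modulo I of the monomials X^w * X^u, where w ranges over all finite lists with entries in {0, 2} ⊆ Fin 4 and u ranges over all finite lists with entries in {1, 3} ⊆ Fin 4, form a basis of the quotient FreeAlgebra (ZMod (p^n)) (Fin 4) ⧸ I as a ZMod (p^n)-module: this family is ZMod (p^n)-linearly independent and spans the quotient. -/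
section Span

open Algebra Subalgebra

variable {R E : Type*} [CommRing R] [Ring E] [Algebra R E]

theorem mul_adjoin_le_of_forall {D : Subalgebra R E} {s : Set E}
    (h : ∀ c ∈ s, ∀ d ∈ D, d * c ∈ toSubmodule (adjoin R s) * toSubmodule D) :
    toSubmodule D * toSubmodule (adjoin R s) ≤ toSubmodule (adjoin R s) * toSubmodule D := by
  suffices H : ∀ c ∈ adjoin R s, ∀ d ∈ D, d * c ∈ toSubmodule (adjoin R s) * toSubmodule D from
    Submodule.mul_le.2 fun d hd c hc => H c hc d hd
  intro c hc
  induction hc using adjoin_induction with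
  | mem c hc => exact h c hc
  | algebraMap r =>
    intro d hd
    rw [← Algebra.commutes]
    exact Submodule.mul_mem_mul ((adjoin R s).algebraMap_mem r) hd
  | add c c' _ _ h₁ h₂ =>
    intro d hd
    rw [mul_add]
    exact add_mem (h₁ d hd) (h₂ d hd)
  | mul c c' _ _ h₁ h₂ =>
    intro d hd
    rw [← mul_assoc]
    refine Submodule.mul_induction_on (h₁ d hd) (fun k hk d' hd' => ?_) fun a b ha hb => ?_
    · have := Submodule.mul_mem_mul (M := toSubmodule (adjoin R s)) hk (h₂ d' hd')
      rwa [← mul_assoc, ← mul_assoc, (isIdempotentElem_toSubmodule _).eq] at this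
    · rw [add_mul]
      exact add_mem ha hb

theorem adjoin_mul_le_of_forall {C : Subalgebra R E} {t : Set E}
    (h : ∀ d ∈ t, ∀ c ∈ C, d * c ∈ toSubmodule C * toSubmodule (adjoin R t)) :
    toSubmodule (adjoin R t) * toSubmodule C ≤ toSubmodule C * toSubmodule (adjoin R t) := by
  suffices H : ∀ d ∈ adjoin R t, ∀ c ∈ C, d * c ∈ toSubmodule C * toSubmodule (adjoin R t) from
    Submodule.mul_le.2 H
  intro d hd
  induction hd using adjoin_induction with
  | mem d hd => exact h d hd
  | algebraMap r =>
    intro c hc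
    rw [Algebra.commutes]
    exact Submodule.mul_mem_mul hc ((adjoin R t).algebraMap_mem r)
  | add d d' _ _ h₁ h₂ =>
    intro c hc
    rw [add_mul]
    exact add_mem (h₁ c hc) (h₂ c hc)
  | mul d d' _ _ h₁ h₂ =>
    intro c hc
    rw [mul_assoc]
    refine Submodule.mul_induction_on (h₂ c hc) (fun c' hc' k hk => ?_) fun a b ha hb => ?_
    · have := Submodule.mul_mem_mul (N := toSubmodule (adjoin R t)) (h₁ c' hc') hk
      rwa [mul_assoc, mul_assoc, (isIdempotentElem_toSubmodule _).eq] at this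
    · rw [mul_add]
      exact add_mem ha hb

theorem mul_adjoin_le {D : Subalgebra R E} {s : Set E}
    (h : ∀ c ∈ s, toSubmodule D * toSubmodule (adjoin R {c}) ≤
      toSubmodule (adjoin R {c}) * toSubmodule D) :
    toSubmodule D * toSubmodule (adjoin R s) ≤ toSubmodule (adjoin R s) * toSubmodule D :=
  mul_adjoin_le_of_forall fun c hc _ hd =>
    mul_le_mul' (toSubmodule.monotone (adjoin_mono (Set.singleton_subset_iff.2 hc))) le_rfl
      (h c hc (Submodule.mul_mem_mul hd (self_mem_adjoin_singleton R c)))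

theorem adjoin_mul_le {C : Subalgebra R E} {t : Set E}
    (h : ∀ d ∈ t, toSubmodule (adjoin R {d}) * toSubmodule C ≤
      toSubmodule C * toSubmodule (adjoin R {d})) :
    toSubmodule (adjoin R t) * toSubmodule C ≤ toSubmodule C * toSubmodule (adjoin R t) :=
  adjoin_mul_le_of_forall fun d hd _ hc =>
    mul_le_mul' le_rfl (toSubmodule.monotone (adjoin_mono (Set.singleton_subset_iff.2 hd)))
      (h d hd (Submodule.mul_mem_mul (self_mem_adjoin_singleton R d) hc))

theorem adjoin_union_le_mul {s t : Set E}
    (h : toSubmodule (adjoin R t) * toSubmodule (adjoin R s) ≤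
      toSubmodule (adjoin R s) * toSubmodule (adjoin R t)) :
    toSubmodule (adjoin R (s ∪ t)) ≤ toSubmodule (adjoin R s) * toSubmodule (adjoin R t) := by
  intro z hz
  replace hz : z ∈ adjoin R (s ∪ t) := hz
  induction hz using adjoin_induction with
  | mem z hz =>
    rcases hz with hz | hz
    · rw [← mul_one z]
      exact Submodule.mul_mem_mul (subset_adjoin hz) (one_mem (adjoin R t))
    · rw [← one_mul z]
      exact Submodule.mul_mem_mul (one_mem (adjoin R s)) (subset_adjoin hz)
  | algebraMap r =>
    rw [← mul_one (algebraMap R E r)]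
    exact Submodule.mul_mem_mul ((adjoin R s).algebraMap_mem r) (one_mem (adjoin R t))
  | add a b _ _ ha hb => exact add_mem ha hb
  | mul a b _ _ ha hb =>
    have := Submodule.mul_mem_mul ha hb
    rw [mul_assoc, ← mul_assoc (toSubmodule (adjoin R t))] at this
    have h' := mul_le_mul_right (mul_le_mul_left h (toSubmodule (adjoin R t)))
      (toSubmodule (adjoin R s)) 
    have := h' this
    rwa [mul_assoc, (isIdempotentElem_toSubmodule _).eq, ← mul_assoc, (isIdempotentElem_toSubmodule _).eq] at this

theorem adjoin_image_le_span_words {Λ : Type*} (x : Λ → E) (P : Λ → Prop) :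
    toSubmodule (adjoin R (x '' {j | P j})) ≤
      Submodule.span R (Set.range fun w : {w : List Λ // ∀ j ∈ w, P j} => (w.1.map x).prod) := by
  rw [adjoin_eq_span]
  refine Submodule.span_mono fun z hz => ?_
  induction hz using Submonoid.closure_induction with
  | mem z hz =>
    obtain ⟨j, hj, rfl⟩ := hz
    exact ⟨⟨[j], by simpa using hj⟩, by simp⟩
  | one => exact ⟨⟨[], by simp⟩, by simp⟩
  | mul a b _ _ ha hb =>
    obtain ⟨⟨v, hv⟩, rfl⟩ := ha
    obtain ⟨⟨w, hw⟩, rfl⟩ := hb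
    exact ⟨⟨v ++ w, by simpa [or_imp, forall_and] using ⟨hv, hw⟩⟩, by simp⟩

theorem adjoin_range_le_span_words {Λ : Type*} (x : Λ → E) :
    toSubmodule (adjoin R (Set.range x)) ≤
      Submodule.span R (Set.range fun w : List Λ => (w.map x).prod) := by
  have h := adjoin_image_le_span_words (R := R) x fun _ => True
  rw [Set.ofPred_true, Set.image_univ] at h
  refine h.trans (Submodule.span_mono ?_)
  rintro _ ⟨w, rfl⟩
  exact ⟨w.1, rfl⟩

theorem adjoin_singleton_le_span_pow (x : E) :
    toSubmodule (adjoin R {x}) ≤ Submodule.span R (Set.range fun j : ℕ => x ^ j) := by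
  rw [adjoin_eq_span]
  refine Submodule.span_mono fun z hz => ?_
  obtain ⟨j, rfl⟩ := Submonoid.mem_closure_singleton.1 hz
  exact ⟨j, rfl⟩

theorem mul_le_span_range_mul {ι κ : Type*} {M N : Submodule R E} {c : ι → E} {d : κ → E}
    (hM : M ≤ Submodule.span R (Set.range c)) (hN : N ≤ Submodule.span R (Set.range d)) :
    M * N ≤ Submodule.span R (Set.range fun i : ι × κ => c i.1 * d i.2) := by
  refine (mul_le_mul' hM hN).trans ?_
  rw [Submodule.span_mul_span]
  refine Submodule.span_mono ?_
  rintro _ ⟨_, ⟨i, rfl⟩, _, ⟨j, rfl⟩, rfl⟩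
  exact ⟨(i, j), rfl⟩

end Span

section Ore

open Polynomial Algebra Subalgebra

variable {R : Type*} [CommRing R]

/-- `t` can be moved past polynomials in `s` from left to right. -/
def LeftOre {E : Type*} [Ring E] [Algebra R E] (σ δ : R[X] → R[X]) (s t : E) : Prop :=
  ∀ f, t * aeval s f = aeval s (σ f) * t + aeval s (δ f)

/-- `t` can be moved past polynomials in `s` from right to left. -/
def RightOre {E : Type*} [Ring E] [Algebra R E] (σ δ : R[X] → R[X]) (s t : E) : Prop :=
  ∀ f, aeval s f * t = t * aeval s (σ f) + aeval s (δ f)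

variable {E F : Type*} [Ring E] [Algebra R E] [Ring F] [Algebra R F]

theorem aeval_op (s : E) (f : R[X]) :
    aeval (MulOpposite.op s) f = MulOpposite.op (aeval s f) := by
  induction f using Polynomial.induction_on' with
  | add f g hf hg => simp [hf, hg]
  | monomial n a => simp [aeval_monomial, Algebra.commutes, MulOpposite.algebraMap_apply]

theorem LeftOre.map {σ δ : R[X] → R[X]} {s t : E} (h : LeftOre σ δ s t) (φ : E →ₐ[R] F) :
    LeftOre σ δ (φ s) (φ t) := by
  intro f
  simpa [aeval_algHom_apply] using congrArg φ (h f)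

theorem RightOre.map {σ δ : R[X] → R[X]} {s t : E} (h : RightOre σ δ s t) (φ : E →ₐ[R] F) :
    RightOre σ δ (φ s) (φ t) := by
  intro f
  simpa [aeval_algHom_apply] using congrArg φ (h f)

theorem RightOre.op {σ δ : R[X] → R[X]} {s t : E} (h : RightOre σ δ s t) :
    LeftOre σ δ (MulOpposite.op s) (MulOpposite.op t) := by
  intro f
  simpa [aeval_op] using congrArg MulOpposite.op (h f)

theorem LeftOre.op {σ δ : R[X] → R[X]} {s t : E} (h : LeftOre σ δ s t) :
    RightOre σ δ (MulOpposite.op s) (MulOpposite.op t) := by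
  intro f
  simpa [aeval_op] using congrArg MulOpposite.op (h f)

theorem LeftOre.mul_le {σ δ : R[X] → R[X]} {s t : E} (h : LeftOre σ δ s t) :
    toSubmodule (adjoin R {t}) * toSubmodule (adjoin R {s}) ≤
      toSubmodule (adjoin R {s}) * toSubmodule (adjoin R {t}) := by
  refine adjoin_mul_le_of_forall fun d hd c hc => ?_
  rw [Set.mem_singleton_iff.1 hd]
  obtain ⟨f, rfl⟩ := by rwa [adjoin_singleton_eq_range_aeval] at hc
  rw [AlgHom.toRingHom_eq_coe, RingHom.coe_coe, h f, ← mul_one (aeval s (δ f))]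
  exact add_mem
    (Submodule.mul_mem_mul (aeval_mem_adjoin_singleton R s) (self_mem_adjoin_singleton R t))
    (Submodule.mul_mem_mul (aeval_mem_adjoin_singleton R s) (one_mem (adjoin R {t})))

theorem RightOre.mul_le {σ δ : R[X] → R[X]} {s t : E} (h : RightOre σ δ s t) :
    toSubmodule (adjoin R {s}) * toSubmodule (adjoin R {t}) ≤
      toSubmodule (adjoin R {t}) * toSubmodule (adjoin R {s}) := by
  refine mul_adjoin_le_of_forall fun d hd c hc => ?_
  rw [Set.mem_singleton_iff.1 hd]
  obtain ⟨f, rfl⟩ := by rwa [adjoin_singleton_eq_range_aeval] at hc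
  rw [AlgHom.toRingHom_eq_coe, RingHom.coe_coe, h f, ← one_mul (aeval s (δ f))]
  exact add_mem
    (Submodule.mul_mem_mul (self_mem_adjoin_singleton R t) (aeval_mem_adjoin_singleton R s))
    (Submodule.mul_mem_mul (one_mem (adjoin R {t})) (aeval_mem_adjoin_singleton R s))

theorem RightOre.symm {σ : R[X] ≃ₐ[R] R[X]} {δ : R[X] →ₗ[R] R[X]} {s t : E}
    (h : RightOre σ δ s t) : LeftOre σ.symm (fun f => -δ (σ.symm f)) s t := by
  intro f
  simp [h (σ.symm f)]

theorem LeftOre.symm {σ : R[X] ≃ₐ[R] R[X]} {δ : R[X] →ₗ[R] R[X]} {s t : E}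
    (h : LeftOre σ δ s t) : RightOre σ.symm (fun f => -δ (σ.symm f)) s t := by
  intro f
  simp [h (σ.symm f)]

theorem RightOre.of_X {σ : R[X] ≃ₐ[R] R[X]} {δ : R[X] →ₗ[R] R[X]}
    (hδ : ∀ f g, δ (f * g) = σ f * δ g + δ f * g) {s t : E}
    (h : s * t = t * aeval s (σ X) + aeval s (δ X)) : RightOre σ δ s t := by
  have h1 : δ 1 = 0 := by simpa using hδ 1 1
  intro f
  induction f using Polynomial.induction_on with
  | C a =>
    have : (C a : R[X]) = a • 1 := by rw [smul_eq_C_mul, mul_one]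
    simp [this, h1]
  | add f g hf hg =>
    simp only [map_add, add_mul, mul_add, hf, hg]
    abel
  | monomial n a hf =>
    have key (g : R[X]) : δ (X * g) = σ g * δ X + X * δ g := by rw [mul_comm, hδ]; ring
    rw [pow_succ', mul_left_comm]
    generalize C a * X ^ n = g at hf
    have key : δ (X * g) = δ X * σ g + X * δ g := by rw [mul_comm, hδ]; ring
    rw [map_mul, aeval_X, mul_assoc, hf, mul_add, ← mul_assoc, h, key]
    simp only [map_mul, map_add, add_mul, mul_assoc, add_assoc, aeval_X]

end Ore

section Glue

open Polynomial Algebra Subalgebra Module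

universe u v

variable {R : Type u} [CommRing R]

theorem exists_basis_subalgebra {V : Type*} [AddCommGroup V] [Module R V] {E : Type u} [Ring E]
    [Algebra R E] {I : Type*} (e : Basis I R V) (ev : E →ₗ[R] V) (s : Set E) (b : I → E)
    (hb : ∀ i, ev (b i) = e i) (hmem : ∀ i, b i ∈ adjoin R s)
    (hsp : toSubmodule (adjoin R s) ≤ Submodule.span R (Set.range b)) :
    ∃ (A : Type u) (_ : Ring A) (_ : Algebra R A) (φ : A →ₐ[R] E) (B : Basis I R A),
      Function.Injective φ ∧ (∀ x ∈ s, ∃ a, φ a = x) ∧ ∀ i, φ (B i) = b i := by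
  let A := adjoin R s
  have hli : LinearIndependent R fun i => (⟨b i, hmem i⟩ : A) := by
    refine LinearIndependent.of_comp (ev.comp A.val.toLinearMap) ?_
    convert e.linearIndependent using 1
    funext i
    exact hb i
  refine ⟨A, inferInstance, inferInstance, A.val, Basis.mk hli ?_, Subtype.val_injective,
    fun x hx => ⟨⟨x, subset_adjoin hx⟩, rfl⟩, fun i => by rw [Basis.mk_apply]; rfl⟩
  rintro ⟨z, hz⟩ -
  have hz' := hsp hz
  have hr : Set.range b = A.val.toLinearMap '' Set.range fun i => (⟨b i, hmem i⟩ : A) := by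
    rw [← Set.range_comp]
    rfl
  rw [hr, Submodule.span_image] at hz'
  obtain ⟨y, hy, hyz⟩ := hz'
  rwa [show y = ⟨z, hz⟩ from Subtype.ext hyz] at hy

theorem LeftOre.of_map {E F : Type*} [Ring E] [Algebra R E] [Ring F] [Algebra R F]
    {σ δ : R[X] → R[X]} {s t : E} {φ : E →ₐ[R] F} (hφ : Function.Injective φ)
    (h : LeftOre σ δ (φ s) (φ t)) : LeftOre σ δ s t := by
  intro f
  apply hφ
  simpa [aeval_algHom_apply] using h f

theorem exists_leftOre_end (σ : R[X] ≃ₐ[R] R[X]) (δ : R[X] →ₗ[R] R[X])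
    (hδ : ∀ f g, δ (f * g) = σ f * δ g + δ f * g) :
    ∃ S T : End R ((ℕ × ℕ) →₀ R), LeftOre σ δ S T ∧
      ∀ i j, (S ^ i * T ^ j) (Finsupp.single (0, 0) 1) = Finsupp.single (i, j) 1 := by
  have h1 : δ 1 = 0 := by simpa using hδ 1 1
  let e : ℕ → ℕ → (ℕ × ℕ) →₀ R := fun i j => Finsupp.single (i, j) 1
  let S : End R ((ℕ × ℕ) →₀ R) := Finsupp.lmapDomain R R fun ij => (ij.1 + 1, ij.2)
  let T : End R ((ℕ × ℕ) →₀ R) := Finsupp.linearCombination R fun ij =>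
    aeval S (σ (X ^ ij.1)) (e 0 (ij.2 + 1)) + aeval S (δ (X ^ ij.1)) (e 0 ij.2)
  have hS : ∀ i j, S (e i j) = e (i + 1) j := fun i j => by
    simp [S, e, Finsupp.mapDomain_single]
  have hSp : ∀ i j, (S ^ i) (e 0 j) = e i j := by
    intro i j
    induction i with
    | zero => rfl
    | succ i ih => rw [pow_succ', Module.End.mul_apply, ih, hS]
  have hT : ∀ i j, T (e i j) = aeval S (σ (X ^ i)) (e 0 (j + 1)) + aeval S (δ (X ^ i)) (e 0 j) :=
    fun i j => by simp [T, e]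
  have hTf : ∀ (f : R[X]) j, T (aeval S f (e 0 j)) =
      aeval S (σ f) (e 0 (j + 1)) + aeval S (δ f) (e 0 j) := by
    intro f j
    induction f using Polynomial.induction_on' with
    | add f g hf hg =>
      simp only [map_add, LinearMap.add_apply, hf, hg]
      abel
    | monomial n a =>
      have : (monomial n a : R[X]) = a • X ^ n := by rw [smul_X_eq_monomial]
      rw [this]
      simp only [map_smul, LinearMap.smul_apply, ← smul_add, ← hT]
      rw [map_pow, aeval_X, hSp]
  have hT0 : ∀ j, (T ^ j) (e 0 0) = e 0 j := by
    intro j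
    induction j with
    | zero => rfl
    | succ j ih => rw [pow_succ', Module.End.mul_apply, ih, hT]; simp [h1]
  have hO : LeftOre σ δ S T := by
    intro f
    refine Finsupp.lhom_ext' fun ij => LinearMap.ext_ring ?_
    change T (aeval S f (e ij.1 ij.2)) =
      aeval S (σ f) (T (e ij.1 ij.2)) + aeval S (δ f) (e ij.1 ij.2)
    have he : e ij.1 ij.2 = aeval S (X ^ ij.1 : R[X]) (e 0 ij.2) := by
      rw [map_pow, aeval_X, hSp]
    rw [he, ← Module.End.mul_apply (aeval S f), ← map_mul (aeval S), hTf, hTf, hδ]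
    simp only [map_mul, map_add, Module.End.mul_apply, LinearMap.add_apply, add_assoc]
  refine ⟨S, T, hO, fun i j => ?_⟩
  exact (congrArg _ (hT0 j)).trans (hSp i j)

theorem LeftOre.exists_basis {σ δ : R[X] → R[X]} {E : Type u} [Ring E] [Algebra R E] {S T : E}
    (hO : LeftOre σ δ S T) {V : Type*} [AddCommGroup V] [Module R V] (e : Basis (ℕ × ℕ) R V)
    (ev : E →ₗ[R] V) (hev : ∀ i j, ev (S ^ i * T ^ j) = e (i, j)) :
    ∃ (A : Type u) (_ : Ring A) (_ : Algebra R A) (x y : A) (B : Basis (ℕ × ℕ) R A),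
      (∀ i j, B (i, j) = x ^ i * y ^ j) ∧ LeftOre σ δ x y := by
  have hSm : S ∈ adjoin R ({S} ∪ {T}) := subset_adjoin (by simp)
  have hTm : T ∈ adjoin R ({S} ∪ {T}) := subset_adjoin (by simp)
  obtain ⟨A, _, _, φ, B, hφ, hs, hB⟩ := exists_basis_subalgebra e ev ({S} ∪ {T})
    (fun ij : ℕ × ℕ => S ^ ij.1 * T ^ ij.2) (fun ij => hev _ _)
    (fun ij => mul_mem (pow_mem hSm _) (pow_mem hTm _))
    ((adjoin_union_le_mul hO.mul_le).trans (mul_le_span_range_mul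
      (adjoin_singleton_le_span_pow S) (adjoin_singleton_le_span_pow T)))
  obtain ⟨x, rfl⟩ := hs S (by simp)
  obtain ⟨y, rfl⟩ := hs T (by simp)
  exact ⟨A, _, _, x, y, B, fun i j => hφ (by simp [hB]), hO.of_map hφ⟩

theorem exists_leftOre_basis (σ : R[X] ≃ₐ[R] R[X]) (δ : R[X] →ₗ[R] R[X])
    (hδ : ∀ f g, δ (f * g) = σ f * δ g + δ f * g) :
    ∃ (A : Type u) (_ : Ring A) (_ : Algebra R A) (x y : A) (B : Basis (ℕ × ℕ) R A),
      (∀ i j, B (i, j) = x ^ i * y ^ j) ∧ LeftOre σ δ x y := by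
  obtain ⟨S, T, hO, hST⟩ := exists_leftOre_end σ δ hδ
  exact hO.exists_basis Finsupp.basisSingleOne (LinearMap.applyₗ (Finsupp.single (0, 0) 1))
    fun i j => (hST i j).trans (by rw [Finsupp.coe_basisSingleOne])

theorem dropWhile_replicate_append {Λ : Type*} [DecidableEq Λ] (ℓ : Λ) (j : ℕ) (u : List Λ) :
    (List.replicate j ℓ ++ u).dropWhile (· = ℓ) = u.dropWhile (· = ℓ) := by
  induction j with
  | zero => rfl
  | succ j ih => simp [List.replicate_succ, ih]

theorem takeWhile_replicate_append {Λ : Type*} [DecidableEq Λ] (ℓ : Λ) (j : ℕ) (u : List Λ) :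
    (List.replicate j ℓ ++ u).takeWhile (· = ℓ) =
      List.replicate j ℓ ++ u.takeWhile (· = ℓ) := by
  induction j with
  | zero => rfl
  | succ j ih => simp [List.replicate_succ, ih]

theorem takeWhile_dropWhile {Λ : Type*} [DecidableEq Λ] (ℓ : Λ) (u : List Λ) :
    (u.dropWhile (· = ℓ)).takeWhile (· = ℓ) = [] := by
  induction u with
  | nil => rfl
  | cons a u ih => by_cases h : a = ℓ <;> simp [h, ih]

theorem replicate_append_dropWhile {Λ : Type*} [DecidableEq Λ] (ℓ : Λ) (u : List Λ) :
    List.replicate (u.takeWhile (· = ℓ)).length ℓ ++ u.dropWhile (· = ℓ) = u := by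
  induction u with
  | nil => rfl
  | cons a u ih =>
    by_cases h : a = ℓ
    · simpa [h, List.replicate_succ] using ih
    · simp [h]

/-- An algebra with a basis indexed by `ι × ℕ` acts on the free module on `ι × List Λ`, in which
it sees a word as a power of the letter `ℓ` followed by a word not beginning with `ℓ`. -/
theorem exists_glue {ι : Type*} {Λ : Type*} [DecidableEq Λ] {A : Type*} [Ring A] [Algebra R A]
    (b : Basis (ι × ℕ) R A) (ℓ : Λ) :
    ∃ T : A →ₐ[R] End R ((ι × List Λ) →₀ R), ∀ z i i' d, (∀ j, z * b (i, j) = b (i', j + d)) →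
      ∀ u, T z (Finsupp.single (i, u) 1) =
        Finsupp.single (i', List.replicate d ℓ ++ u) 1 := by
  let push : List Λ → A →ₗ[R] ((ι × List Λ) →₀ R) := fun u =>
    b.constr R fun ij => Finsupp.single (ij.1, List.replicate ij.2 ℓ ++ u) 1
  have hpush : ∀ u i j, push u (b (i, j)) = Finsupp.single (i, List.replicate j ℓ ++ u) 1 :=
    fun u i j => by simp [push, Basis.constr_basis]
  let drop : List Λ → List Λ := fun u => u.dropWhile (· = ℓ)
  let cnt : List Λ → ℕ := fun u => (u.takeWhile (· = ℓ)).length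
  let T : A → End R ((ι × List Λ) →₀ R) := fun z => Finsupp.linearCombination R fun iu =>
    push (drop iu.2) (z * b (iu.1, cnt iu.2))
  have hT : ∀ z i u, T z (Finsupp.single (i, u) 1) = push (drop u) (z * b (i, cnt u)) :=
    fun z i u => by simp [T]
  have hdrop : ∀ j u, drop (List.replicate j ℓ ++ drop u) = drop u := fun j u => by
    simp only [drop, dropWhile_replicate_append, List.dropWhile_idempotent]
  have hcnt : ∀ j u, cnt (List.replicate j ℓ ++ drop u) = j := fun j u => by
    have h0 : (drop u).takeWhile (· = ℓ) = [] := by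
      exact takeWhile_dropWhile ℓ u
    simp only [cnt, takeWhile_replicate_append, h0, List.append_nil, List.length_replicate]
  have hTpush : ∀ z u y, T z (push (drop u) y) = push (drop u) (z * y) := by
    intro z u y
    have : T z ∘ₗ push (drop u) = push (drop u) ∘ₗ LinearMap.mulLeft R z := by
      refine b.ext fun ij => ?_
      simp only [LinearMap.comp_apply, LinearMap.mulLeft_apply]
      rw [hpush, hT, hdrop, hcnt]
    exact LinearMap.congr_fun this y
  have hsingle : ∀ i u, push (drop u) (b (i, cnt u)) = Finsupp.single (i, u) 1 := fun i u => by
    rw [hpush]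
    simp only [drop, cnt, replicate_append_dropWhile]
  refine ⟨AlgHom.ofLinearMap ⟨⟨T, fun z z' => ?_⟩, fun r z => ?_⟩ ?_ fun z z' => ?_, ?_⟩
  · refine Finsupp.lhom_ext' fun iu => LinearMap.ext_ring ?_
    simp [hT, add_mul]
  · refine Finsupp.lhom_ext' fun iu => LinearMap.ext_ring ?_
    simp [hT]
  · refine Finsupp.lhom_ext' fun iu => LinearMap.ext_ring ?_
    simp [hT, hsingle]
  · refine Finsupp.lhom_ext' fun iu => LinearMap.ext_ring ?_
    simp [hT, hTpush, mul_assoc]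
  · intro z i i' d h u
    change T z _ = _
    rw [hT, h, hpush, add_comm, List.replicate_add, List.append_assoc]
    simp only [drop, cnt, replicate_append_dropWhile]

end Glue

section Amalgam

open Polynomial Algebra Subalgebra Module MulOpposite

universe u

variable {R : Type u} [CommRing R] {σ : R[X] ≃ₐ[R] R[X]} {δ : R[X] →ₗ[R] R[X]}

theorem LeftOre.exists_words_basis {σ δ : R[X] → R[X]} {E : Type u} [Ring E] [Algebra R E]
    {t : Bool → E} {c : E} (h₁ : LeftOre σ δ c (t true)) (h₂ : LeftOre σ δ (t false) c)
    (h : toSubmodule (adjoin R {t false}) * toSubmodule (adjoin R {c}) ≤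
      toSubmodule (adjoin R {c}) * toSubmodule (adjoin R {t false}))
    {V : Type*} [AddCommGroup V] [Module R V] (e : Basis (ℕ × List Bool) R V) (ev : E →ₗ[R] V)
    (hev : ∀ j w, ev (c ^ j * (w.map t).prod) = e (j, w)) :
    ∃ (A : Type u) (_ : Ring A) (_ : Algebra R A) (t : Bool → A) (c : A)
      (B : Basis (ℕ × List Bool) R A), (∀ j w, B (j, w) = c ^ j * (w.map t).prod) ∧
      LeftOre σ δ c (t true) ∧ LeftOre σ δ (t false) c := by
  have hc : c ∈ adjoin R ({c} ∪ Set.range t) := subset_adjoin (Or.inl rfl)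
  have ht : ∀ b, t b ∈ adjoin R ({c} ∪ Set.range t) := fun b => subset_adjoin (Or.inr ⟨b, rfl⟩)
  have hle : toSubmodule (adjoin R (Set.range t)) * toSubmodule (adjoin R {c}) ≤
      toSubmodule (adjoin R {c}) * toSubmodule (adjoin R (Set.range t)) := by
    refine adjoin_mul_le ?_
    rintro _ ⟨_ | _, rfl⟩
    exacts [h, h₁.mul_le]
  have hmem : ∀ jw : ℕ × List Bool,
      c ^ jw.1 * (jw.2.map t).prod ∈ adjoin R ({c} ∪ Set.range t) := by
    refine fun jw => mul_mem (pow_mem hc _) (Subalgebra.list_prod_mem _ fun z hz => ?_)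
    obtain ⟨b, -, rfl⟩ := List.mem_map.1 hz
    exact ht b
  have hsp := (adjoin_union_le_mul hle).trans (mul_le_span_range_mul
    (adjoin_singleton_le_span_pow c) (adjoin_range_le_span_words t))
  obtain ⟨A, _, _, φ, B, hφ, hs, hB⟩ :=
    exists_basis_subalgebra e ev _ _ (fun jw => hev jw.1 jw.2) hmem hsp
  obtain ⟨c', rfl⟩ := hs c (Or.inl rfl)
  choose t' ht' using fun b => hs (t b) (Or.inr ⟨b, rfl⟩)
  obtain rfl : (fun b => φ (t' b)) = t := funext ht'
  refine ⟨A, _, _, t', c', B, fun j w => hφ ?_, h₁.of_map hφ, h₂.of_map hφ⟩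
  rw [hB, map_mul, map_pow, map_list_prod, List.map_map]
  rfl

theorem list_prod_apply_single {ι Λ : Type*} {t : Λ → End R ((ι × List Λ) →₀ R)} {i : ι}
    (ht : ∀ b u, t b (Finsupp.single (i, u) 1) = Finsupp.single (i, b :: u) 1) (w u : List Λ) :
    (w.map t).prod (Finsupp.single (i, u) 1) = Finsupp.single (i, w ++ u) 1 := by
  induction w with
  | nil => rfl
  | cons b w ih => rw [List.map_cons, List.prod_cons, Module.End.mul_apply, ih, ht]; rfl

theorem exists_leftOre_basis_flip (hδ : ∀ f g, δ (f * g) = σ f * δ g + δ f * g) :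
    ∃ (A : Type u) (_ : Ring A) (_ : Algebra R A) (x y : A) (B : Basis (ℕ × ℕ) R A),
      (∀ i j, B (i, j) = y ^ i * x ^ j) ∧ LeftOre σ δ x y := by
  obtain ⟨A, _, _, x, y, B, hB, h⟩ := exists_leftOre_basis σ.symm (-(δ ∘ₗ σ.symm.toLinearMap))
    fun f g => by
      simp only [LinearMap.neg_apply, LinearMap.comp_apply, AlgEquiv.toLinearMap_apply]
      rw [mul_comm f g, map_mul, hδ, AlgEquiv.apply_symm_apply]
      ring
  refine ⟨Aᵐᵒᵖ, inferInstance, inferInstance, op x, op y,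
    (B.map (opLinearEquiv R)).reindex (Equiv.prodComm ℕ ℕ), fun i j => by simp [hB], fun f => ?_⟩
  simpa using h.symm.op f

theorem exists_leftOre_words_end_of_basis {σ δ : R[X] → R[X]} {A₁ A₂ : Type u} [Ring A₁]
    [Algebra R A₁] [Ring A₂] [Algebra R A₂] {x₁ y₁ : A₁} {x₂ y₂ : A₂}
    {B₁ : Basis (ℕ × ℕ) R A₁} {B₂ : Basis (ℕ × ℕ) R A₂}
    (hB₁ : ∀ i j, B₁ (i, j) = x₁ ^ i * y₁ ^ j) (hB₂ : ∀ i j, B₂ (i, j) = y₂ ^ i * x₂ ^ j)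
    (h₁ : LeftOre σ δ x₁ y₁) (h₂ : LeftOre σ δ x₂ y₂) :
    ∃ (t : Bool → End R ((ℕ × List Bool) →₀ R)) (c : End R ((ℕ × List Bool) →₀ R)),
      LeftOre σ δ c (t true) ∧ LeftOre σ δ (t false) c ∧
      (∀ b u, t b (Finsupp.single (0, u) 1) = Finsupp.single (0, b :: u) 1) ∧
      ∀ j u, c (Finsupp.single (j, u) 1) = Finsupp.single (j + 1, u) 1 := by
  obtain ⟨T₁, hT₁⟩ := exists_glue B₁ true
  obtain ⟨T₂, hT₂⟩ := exists_glue B₂ false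
  have hx₁ : ∀ j u, T₁ x₁ (Finsupp.single (j, u) 1) = Finsupp.single (j + 1, u) 1 := fun j u =>
    hT₁ x₁ j (j + 1) 0 (fun i => by rw [hB₁, add_zero, hB₁, pow_succ', mul_assoc]) u
  have hy₂ : ∀ j u, T₂ y₂ (Finsupp.single (j, u) 1) = Finsupp.single (j + 1, u) 1 := fun j u =>
    hT₂ y₂ j (j + 1) 0 (fun i => by rw [hB₂, add_zero, hB₂, pow_succ', mul_assoc]) u
  have hy₁ : ∀ u, T₁ y₁ (Finsupp.single (0, u) 1) = Finsupp.single (0, true :: u) 1 := fun u =>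
    hT₁ y₁ 0 0 1 (fun i => by rw [hB₁, hB₁, pow_zero, one_mul, one_mul, pow_succ']) u
  have hx₂ : ∀ u, T₂ x₂ (Finsupp.single (0, u) 1) = Finsupp.single (0, false :: u) 1 := fun u =>
    hT₂ x₂ 0 0 1 (fun i => by rw [hB₂, hB₂, pow_zero, one_mul, one_mul, pow_succ']) u
  have hc : T₁ x₁ = T₂ y₂ := by
    refine Finsupp.lhom_ext' fun ju => LinearMap.ext_ring ?_
    exact (hx₁ _ _).trans (hy₂ _ _).symm
  refine ⟨fun b => bif b then T₁ y₁ else T₂ x₂, T₁ x₁, h₁.map (F := End R ((ℕ × List Bool) →₀ R)) T₁, ?_, ?_, hx₁⟩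
  · rw [hc]
    exact h₂.map (F := End R ((ℕ × List Bool) →₀ R)) T₂
  · rintro (_ | _) u
    exacts [hx₂ u, hy₁ u]

theorem exists_leftOre_words_end (hδ : ∀ f g, δ (f * g) = σ f * δ g + δ f * g) :
    ∃ (t : Bool → End R ((ℕ × List Bool) →₀ R)) (c : End R ((ℕ × List Bool) →₀ R)),
      LeftOre σ δ c (t true) ∧ LeftOre σ δ (t false) c ∧
      (∀ b u, t b (Finsupp.single (0, u) 1) = Finsupp.single (0, b :: u) 1) ∧
      ∀ j u, c (Finsupp.single (j, u) 1) = Finsupp.single (j + 1, u) 1 := by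
  obtain ⟨A₁, _, _, x₁, y₁, B₁, hB₁, h₁⟩ := exists_leftOre_basis σ δ hδ
  obtain ⟨A₂, _, _, x₂, y₂, B₂, hB₂, h₂⟩ := exists_leftOre_basis_flip hδ
  exact exists_leftOre_words_end_of_basis hB₁ hB₂ h₁ h₂

theorem exists_rightOre_words_basis (hδ : ∀ f g, δ (f * g) = σ f * δ g + δ f * g) :
    ∃ (A : Type u) (_ : Ring A) (_ : Algebra R A) (t : Bool → A) (c : A)
      (B : Basis (List Bool × ℕ) R A), (∀ w j, B (w, j) = (w.map t).prod * c ^ j) ∧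
      RightOre σ δ c (t true) ∧ RightOre σ δ (t false) c := by
  obtain ⟨t, c, h₁, h₂, ht, hc⟩ := exists_leftOre_words_end (σ := σ) hδ
  have hcp : ∀ (j : ℕ) u, (c ^ j) (Finsupp.single (0, u) 1) = Finsupp.single (j, u) 1 := by
    intro j u
    induction j with
    | zero => rfl
    | succ j ih => rw [pow_succ', Module.End.mul_apply, ih, hc]
  obtain ⟨A, _, _, t, c, B, hB, h₁, h₂⟩ := h₁.exists_words_basis h₂ h₂.symm.mul_le
    Finsupp.basisSingleOne (LinearMap.applyₗ (Finsupp.single (0, List.nil) 1)) fun j w => by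
      rw [Finsupp.coe_basisSingleOne]
      refine (congrArg (c ^ j) (list_prod_apply_single ht w List.nil)).trans ?_
      rw [hcp, List.append_nil]
  refine ⟨Aᵐᵒᵖ, inferInstance, inferInstance, fun b => op (t b), op c,
    (B.map (opLinearEquiv R)).reindex
      ((Equiv.prodComm _ _).trans
        (Equiv.prodCongr ⟨List.reverse, List.reverse, List.reverse_reverse, List.reverse_reverse⟩
          (Equiv.refl ℕ))),
    fun w j => ?_, h₁.op, h₂.op⟩
  simp [hB, op_list_prod, List.map_reverse, Function.comp_def]

theorem exists_rightOre_end (hδ : ∀ f g, δ (f * g) = σ f * δ g + δ f * g) :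
    ∃ x : Fin 4 → End R ((List Bool × List Bool) →₀ R),
      (∀ i, RightOre σ δ (x (i + 1)) (x i)) ∧
      (∀ w u, x 0 (Finsupp.single (w, u) 1) = Finsupp.single (true :: w, u) 1) ∧
      (∀ w u, x 2 (Finsupp.single (w, u) 1) = Finsupp.single (false :: w, u) 1) ∧
      (∀ u, x 1 (Finsupp.single ([], u) 1) = Finsupp.single ([], true :: u) 1) ∧
      ∀ u, x 3 (Finsupp.single ([], u) 1) = Finsupp.single ([], false :: u) 1 := by
  obtain ⟨A, _, _, t, c, B, hB, h₁, h₂⟩ := exists_rightOre_words_basis (σ := σ) hδ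
  obtain ⟨T₁, hT₁⟩ := exists_glue B true
  obtain ⟨T₂, hT₂⟩ := exists_glue (B.reindex (Equiv.prodCongr
    ⟨List.map not, List.map not, fun w => by simp [Function.comp_def], fun w => by simp [Function.comp_def]⟩ (Equiv.refl ℕ))) false
  have ht₁ : ∀ b w u, T₁ (t b) (Finsupp.single (w, u) 1) = Finsupp.single (b :: w, u) 1 :=
    fun b w u => hT₁ (t b) w (b :: w) 0 (fun j => by simp [hB, mul_assoc]) u
  have ht₂ : ∀ b w u, T₂ (t b) (Finsupp.single (w, u) 1) = Finsupp.single ((!b) :: w, u) 1 :=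
    fun b w u => hT₂ (t b) w ((!b) :: w) 0 (fun j => by simp [hB, mul_assoc]) u
  have hc₁ : ∀ u, T₁ c (Finsupp.single ([], u) 1) = Finsupp.single ([], true :: u) 1 :=
    fun u => hT₁ c List.nil List.nil 1 (fun j => by simp [hB, pow_succ']) u
  have hc₂ : ∀ u, T₂ c (Finsupp.single ([], u) 1) = Finsupp.single ([], false :: u) 1 :=
    fun u => hT₂ c List.nil List.nil 1 (fun j => by simp [hB, pow_succ']) u
  have ht : ∀ b, T₁ (t b) = T₂ (t !b) := by
    refine fun b => Finsupp.lhom_ext' fun wu => LinearMap.ext_ring ?_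
    refine (ht₁ _ _ _).trans ((ht₂ _ _ _).trans ?_).symm
    rw [Bool.not_not]
  refine ⟨![T₁ (t true), T₁ c, T₁ (t false), T₂ c], fun i => ?_, ht₁ true, ht₁ false, hc₁, hc₂⟩
  fin_cases i
  · exact h₁.map (F := End R ((List Bool × List Bool) →₀ R)) T₁
  · exact h₂.map (F := End R ((List Bool × List Bool) →₀ R)) T₁
  · change RightOre σ δ (T₂ c) (T₁ (t false))
    rw [ht]
    exact h₁.map (F := End R ((List Bool × List Bool) →₀ R)) T₂
  · change RightOre σ δ (T₁ (t true)) (T₂ c)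
    rw [ht]
    exact h₂.map (F := End R ((List Bool × List Bool) →₀ R)) T₂

end Amalgam

section SkewDerivation

open Polynomial

variable {R : Type*} [CommRing R]

/-- The twisted Leibniz rule is multiplicativity of a triangular representation. -/
theorem exists_skewDerivation (r q : R[X]) :
    ∃ δ : R[X] →ₗ[R] R[X], (∀ f g, δ (f * g) = aeval r f * δ g + δ f * g) ∧ δ X = q := by
  let M : Matrix (Fin 2) (Fin 2) R[X] := !![X, q; 0, r]
  have hM : ∀ f, aeval M f 1 0 = 0 ∧ aeval M f 0 0 = f ∧ aeval M f 1 1 = aeval r f := by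
    intro f
    induction f using Polynomial.induction_on with
    | C a => simp [Matrix.algebraMap_matrix_apply]
    | add f g hf hg => simp [hf, hg]
    | monomial n a h =>
      rw [pow_succ, ← mul_assoc, map_mul (aeval M), map_mul (aeval r), aeval_X, aeval_X]
      simp only [Matrix.mul_apply, Fin.sum_univ_two, h]
      simp [M]
  refine ⟨(Matrix.entryLinearMap R R[X] 0 1) ∘ₗ (aeval M).toLinearMap, fun f g => ?_, ?_⟩
  · rw [mul_comm f g]
    simp [Matrix.mul_apply, Fin.sum_univ_two, hM]
    ring
  · simp [M]

theorem exists_skewDerivation_algEquiv {a : R} (ha : IsNilpotent a) (q : R[X]) :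
    ∃ (σ : R[X] ≃ₐ[R] R[X]) (δ : R[X] →ₗ[R] R[X]),
      (∀ f g, δ (f * g) = σ f * δ g + δ f * g) ∧ σ X = X + C a * q ∧ δ X = q := by
  obtain ⟨δ, hδ, hX⟩ := exists_skewDerivation (X + C a * q) q
  have h1 : δ 1 = 0 := by simpa using hδ 1 1
  have hσ : ∀ f, aeval (X + C a * q) f = f + a • δ f := by
    intro f
    induction f using Polynomial.induction_on with
    | C b =>
      have : δ (C b) = 0 := by rw [← mul_one (C b), ← smul_eq_C_mul, map_smul, h1, smul_zero]
      simp [this]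
    | add f g hf hg => simp only [map_add, hf, hg, smul_add]; abel
    | monomial n b h =>
      rw [pow_succ, ← mul_assoc, map_mul, hδ, h, aeval_X, hX]
      simp only [smul_eq_C_mul]
      ring
  have hunit : IsUnit (1 + a • δ : Module.End R R[X]) := by
    refine IsNilpotent.isUnit_one_add ?_
    obtain ⟨n, hn⟩ := ha
    exact ⟨n, by rw [_root_.smul_pow, hn, zero_smul]⟩
  have hbij : Function.Bijective (aeval (R := R) (X + C a * q)) := by
    convert (Module.End.isUnit_iff _).1 hunit using 1
    exact funext hσ
  exact ⟨AlgEquiv.ofBijective _ hbij, δ, hδ, by simp, hX⟩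

end SkewDerivation

section Integral

open Polynomial

theorem exists_one_add_X_pow {p k : ℕ} (hk : 1 ≤ k) (hdvd : p ∣ k - 1) :
    ∃ q : ℤ[X], (1 + (p : ℤ[X]) * X) ^ k = 1 + (p : ℤ[X]) * (X + (p : ℤ[X]) * q) := by
  obtain ⟨c, hc⟩ := hdvd
  have hm : ∀ k : ℕ, ∃ m : ℤ[X],
      (1 + (p : ℤ[X]) * X) ^ k = 1 + (k : ℤ[X]) * ((p : ℤ[X]) * X) + ((p : ℤ[X]) * X) ^ 2 * m := by
    intro k
    induction k with
    | zero => exact ⟨0, by simp⟩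
    | succ k ih =>
      obtain ⟨m, hm⟩ := ih
      exact ⟨(k : ℤ[X]) + m + (p : ℤ[X]) * X * m, by rw [pow_succ, hm]; push_cast; ring⟩
  obtain ⟨m, hm⟩ := hm k
  refine ⟨(c : ℤ[X]) * X + X ^ 2 * m, ?_⟩
  obtain rfl : k = 1 + p * c := by omega
  rw [hm]
  push_cast
  ring

theorem eq_of_sq_smul_eq {p k : ℕ} (hp : p ≠ 0) {q : ℤ[X]}
    (hq : (1 + (p : ℤ[X]) * X) ^ k = 1 + (p : ℤ[X]) * (X + (p : ℤ[X]) * q)) {E : Type*} [Ring E]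
    [Module.IsTorsionFree ℤ E] {s t h : E}
    (hh : ((p : ℤ) ^ 2) • h = (1 + (p : E) * s) * (1 + (p : E) * t) -
      (1 + (p : E) * t) * (1 + (p : E) * s) ^ k) :
    h = s * t - (t * aeval s (X + (p : ℤ[X]) * q) + aeval s q) := by
  refine smul_right_injective E (r := (p : ℤ) ^ 2) (by positivity) (hh.trans ?_)
  have hs := congrArg (aeval s) hq
  simp only [map_pow, map_add, map_mul, map_one, map_natCast, aeval_X] at hs
  rw [hs]
  simp only [map_add, map_mul, aeval_X, map_natCast]
  have hc : ∀ z : E, (p : E) * z = (p : ℤ) • z := fun z => by simp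
  simp only [hc, mul_add, add_mul, mul_one, one_mul, smul_mul_assoc, mul_smul_comm]
  module

theorem map_aeval_int {A B F : Type*} [Ring A] [Ring B] [Algebra ℤ A] [Algebra ℤ B] [FunLike F A B]
    [RingHomClass F A B] (φ : F) (x : A) (f : ℤ[X]) : φ (aeval x f) = aeval (φ x) f := by
  have := hom_eval₂ f (algebraMap ℤ A) (φ : A →+* B) x
  rwa [RingHom.ext_int ((φ : A →+* B).comp (algebraMap ℤ A)) (algebraMap ℤ B)] at this

end Integral

section Quotient

open Polynomial Subalgebra Module

universe u

variable {R : Type u} [CommRing R] {σ : R[X] ≃ₐ[R] R[X]} {δ : R[X] →ₗ[R] R[X]}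

theorem span_words_eq_top_of_rightOre {E : Type*} [Ring E] [Algebra R E] {x : Fin 4 → E}
    (hx : ∀ i, RightOre σ δ (x (i + 1)) (x i)) (htop : Algebra.adjoin R (Set.range x) = ⊤) :
    Submodule.span R (Set.range fun wu : {w : List (Fin 4) // ∀ j ∈ w, j = 0 ∨ j = 2} ×
      {u : List (Fin 4) // ∀ j ∈ u, j = 1 ∨ j = 3} => (wu.1.1.map x).prod * (wu.2.1.map x).prod) =
        ⊤ := by
  have hle : ∀ i j : Fin 4, (i = 0 ∨ i = 2) → (j = 1 ∨ j = 3) →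
      toSubmodule (Algebra.adjoin R {x j}) * toSubmodule (Algebra.adjoin R {x i}) ≤
        toSubmodule (Algebra.adjoin R {x i}) * toSubmodule (Algebra.adjoin R {x j}) := by
    intro i j hi hj
    obtain rfl | rfl : j = i + 1 ∨ i = j + 1 := by omega
    exacts [(hx i).mul_le, (hx j).symm.mul_le]
  have hU : Set.range x = x '' {j | j = 0 ∨ j = 2} ∪ x '' {j | j = 1 ∨ j = 3} := by
    rw [← Set.image_union, ← Set.image_univ]
    congr 1
    ext j
    simp
    omega
  have h := (adjoin_union_le_mul (R := R) (adjoin_mul_le (t := x '' {j | j = 1 ∨ j = 3})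
    (C := Algebra.adjoin R (x '' {j | j = 0 ∨ j = 2})) (by
      rintro _ ⟨j, hj, rfl⟩
      refine mul_adjoin_le ?_
      rintro _ ⟨i, hi, rfl⟩
      exact hle i j hi hj))).trans (mul_le_span_range_mul
        (adjoin_image_le_span_words x _) (adjoin_image_le_span_words x _))
  rw [← hU, htop, Algebra.top_toSubmodule] at h
  exact top_le_iff.1 h

theorem map_prod_apply_single_left {x : Fin 4 → End R ((List Bool × List Bool) →₀ R)}
    (h₀ : ∀ w u, x 0 (Finsupp.single (w, u) 1) = Finsupp.single (true :: w, u) 1)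
    (h₂ : ∀ w u, x 2 (Finsupp.single (w, u) 1) = Finsupp.single (false :: w, u) 1)
    {w : List (Fin 4)} (hw : ∀ j ∈ w, j = 0 ∨ j = 2) (u : List Bool) :
    (w.map x).prod (Finsupp.single ([], u) 1) =
      Finsupp.single (w.map fun j => decide (j = 0), u) 1 := by
  induction w with
  | nil => rfl
  | cons j w ih =>
    rw [List.map_cons, List.prod_cons, Module.End.mul_apply,
      ih fun i hi => hw i (List.mem_cons_of_mem _ hi)]
    obtain rfl | rfl := hw j List.mem_cons_self
    exacts [h₀ _ _, h₂ _ _]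

theorem map_prod_apply_single_right {x : Fin 4 → End R ((List Bool × List Bool) →₀ R)}
    (h₁ : ∀ u, x 1 (Finsupp.single ([], u) 1) = Finsupp.single ([], true :: u) 1)
    (h₃ : ∀ u, x 3 (Finsupp.single ([], u) 1) = Finsupp.single ([], false :: u) 1)
    {u : List (Fin 4)} (hu : ∀ j ∈ u, j = 1 ∨ j = 3) :
    (u.map x).prod (Finsupp.single ([], []) 1) =
      Finsupp.single ([], u.map fun j => decide (j = 1)) 1 := by
  induction u with
  | nil => rfl
  | cons j u ih =>
    rw [List.map_cons, List.prod_cons, Module.End.mul_apply,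
      ih fun i hi => hu i (List.mem_cons_of_mem _ hi)]
    obtain rfl | rfl := hu j List.mem_cons_self
    exacts [h₁ _, h₃ _]

theorem map_decide_eq_injOn {Λ : Type*} [DecidableEq Λ] {a b : Λ} {w w' : List Λ}
    (hw : ∀ j ∈ w, j = a ∨ j = b) (hw' : ∀ j ∈ w', j = a ∨ j = b)
    (h : (w.map fun j => decide (j = a)) = w'.map fun j => decide (j = a)) : w = w' := by
  induction w generalizing w' with
  | nil => cases w' with
    | nil => rfl
    | cons => simp at h
  | cons j w ih => cases w' with
    | nil => simp at h
    | cons j' w' =>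
      simp only [List.map_cons, List.cons.injEq, decide_eq_decide] at h
      have h₁ := hw j List.mem_cons_self
      have h₂ := hw' j' List.mem_cons_self
      rw [ih (fun i hi => hw i (List.mem_cons_of_mem _ hi))
        (fun i hi => hw' i (List.mem_cons_of_mem _ hi)) h.2]
      grind

theorem linearIndependent_words (hδ : ∀ f g, δ (f * g) = σ f * δ g + δ f * g)
    {E : Type*} [AddCommMonoid E] [Module R E]
    (π : FreeAlgebra R (Fin 4) →ₗ[R] E)
    (hπ : ∀ φ : FreeAlgebra R (Fin 4) →ₐ[R] End R ((List Bool × List Bool) →₀ R),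
      (∀ i, RightOre σ δ (φ (.ι R (i + 1))) (φ (.ι R i))) →
      ∃ ψ : E →ₗ[R] End R ((List Bool × List Bool) →₀ R), ∀ z, ψ (π z) = φ z) :
    LinearIndependent R fun wu : {w : List (Fin 4) // ∀ j ∈ w, j = 0 ∨ j = 2} ×
      {u : List (Fin 4) // ∀ j ∈ u, j = 1 ∨ j = 3} =>
        π ((wu.1.1.map (FreeAlgebra.ι R)).prod * (wu.2.1.map (FreeAlgebra.ι R)).prod) := by
  obtain ⟨x, hx, h₀, h₂, h₁, h₃⟩ := exists_rightOre_end (σ := σ) hδ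
  obtain ⟨ψ, hψ⟩ := hπ (FreeAlgebra.lift R x) fun i => by
    rw [FreeAlgebra.lift_ι_apply, FreeAlgebra.lift_ι_apply]
    exact hx i
  refine LinearIndependent.of_comp
    (LinearMap.applyₗ (Finsupp.single (([] : List Bool), ([] : List Bool)) (1 : R)) ∘ₗ ψ) ?_
  let f : {w : List (Fin 4) // ∀ j ∈ w, j = 0 ∨ j = 2} ×
      {u : List (Fin 4) // ∀ j ∈ u, j = 1 ∨ j = 3} → List Bool × List Bool := fun wu =>
    (wu.1.1.map fun j => decide (j = 0), wu.2.1.map fun j => decide (j = 1))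
  have hf : Function.Injective f := fun wu wu' h =>
    Prod.ext (Subtype.ext (map_decide_eq_injOn wu.1.2 wu'.1.2 (congrArg Prod.fst h)))
      (Subtype.ext (map_decide_eq_injOn wu.2.2 wu'.2.2 (congrArg Prod.snd h)))
  convert (Finsupp.basisSingleOne (R := R)).linearIndependent.comp f hf using 1
  funext wu
  have hw : ∀ w : List (Fin 4), FreeAlgebra.lift R x (w.map (FreeAlgebra.ι R)).prod =
      (w.map x).prod := fun w => by
    rw [map_list_prod, List.map_map, FreeAlgebra.ι_comp_lift]
  simp only [Function.comp_apply, LinearMap.comp_apply, hψ, map_mul, hw, LinearMap.applyₗ_apply_apply,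
    Finsupp.coe_basisSingleOne, Module.End.mul_apply]
  rw [map_prod_apply_single_right h₁ h₃ wu.2.2, map_prod_apply_single_left h₀ h₂ wu.1.2]

theorem words_basis_of_relations (hδ : ∀ f g, δ (f * g) = σ f * δ g + δ f * g)
    (g : Fin 4 → FreeAlgebra R (Fin 4))
    (hg : ∀ i, g i = FreeAlgebra.ι R (i + 1) * FreeAlgebra.ι R i -
      (FreeAlgebra.ι R i * aeval (FreeAlgebra.ι R (i + 1)) (σ X) +
        aeval (FreeAlgebra.ι R (i + 1)) (δ X))) :
    let I := TwoSidedIdeal.span {g 0, g 1, g 2, g 3}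
    let b : {w : List (Fin 4) // ∀ j ∈ w, j = 0 ∨ j = 2} ×
            {u : List (Fin 4) // ∀ j ∈ u, j = 1 ∨ j = 3} → I.ringCon.Quotient := fun wu =>
      RingCon.mk' I.ringCon
        (((wu.1 : List (Fin 4)).map (FreeAlgebra.ι R)).prod *
         ((wu.2 : List (Fin 4)).map (FreeAlgebra.ι R)).prod)
    LinearIndependent R b ∧ Submodule.span R (Set.range b) = ⊤ := by
  intro I b
  let π : FreeAlgebra R (Fin 4) →ₐ[R] I.ringCon.Quotient := I.ringCon.mkₐ R
  have hgI : ∀ i, g i ∈ I := fun i => TwoSidedIdeal.subset_span (by fin_cases i <;> simp)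
  refine ⟨linearIndependent_words hδ π.toLinearMap fun φ hφ => ?_, ?_⟩
  · have hI : I ≤ TwoSidedIdeal.ker φ := by
      rw [TwoSidedIdeal.span_le]
      have : ∀ i, g i ∈ TwoSidedIdeal.ker φ := fun i => by
        rw [TwoSidedIdeal.mem_ker, hg]
        have := hφ i X
        rw [aeval_X] at this
        simp [this, aeval_algHom_apply]
      rintro _ (rfl | rfl | rfl | rfl) <;> exact this _
    exact ⟨(I.ringCon.liftₐ φ (TwoSidedIdeal.ringCon_le_iff.1 hI)).toLinearMap, fun _ => rfl⟩
  · have hx : ∀ i, RightOre σ δ (π (.ι R (i + 1))) (π (.ι R i)) := fun i => by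
      refine RightOre.of_X hδ ?_
      have : π (g i) = 0 := (I.ringCon.eq.2 (hgI i)).trans (map_zero π)
      rw [hg] at this
      rw [← sub_eq_zero]
      simpa [aeval_algHom_apply] using this
    have htop : Algebra.adjoin R (Set.range fun i => π (.ι R i)) = ⊤ := by
      have := congrArg (Subalgebra.map π) (FreeAlgebra.adjoin_range_ι R (Fin 4))
      rw [AlgHom.map_adjoin, ← Set.range_comp, Algebra.map_top] at this
      refine this.trans ((AlgHom.range_eq_top _).2 ?_)
      exact RingCon.mk'_surjective _
    have hb : b = fun wu => (wu.1.1.map fun i => π (.ι R i)).prod *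
        (wu.2.1.map fun i => π (.ι R i)).prod := by
      funext wu
      change π _ = _
      rw [map_mul, map_list_prod, map_list_prod, List.map_map, List.map_map]
      rfl
    rw [hb]
    exact span_words_eq_top_of_rightOre hx htop

end Quotient

/-- With `p` prime, `n ≥ 1`, `k ≥ 2`, `p ∣ k - 1`, let `h i ∈ FreeAlgebra ℤ (Fin 4)`
be the (unique) elements with `p² • h i = (1 + p X_{i+1})(1 + p X_i) - (1 + p X_i)(1 + p X_{i+1})^k`
(indices mod 4), let `g i` be their images in `FreeAlgebra (ZMod (p^n)) (Fin 4)` and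
`I = I(g_0, g_1, g_2, g_3)` the two-sided ideal they generate. Then the images modulo `I` of the
monomials `X^w * X^u`, for `w` a list over `{0, 2}` and `u` a list over `{1, 3}`, form a basis of
the quotient as a `ZMod (p^n)`-module. -/
theorem higman_algebra_basis_left
    (p n k : ℕ) (hp : Nat.Prime p) (hn : 1 ≤ n) (hk : 2 ≤ k) (hdvd : p ∣ k - 1)
    (h : Fin 4 → FreeAlgebra ℤ (Fin 4))
    (hh : ∀ i : Fin 4, ((p : ℤ) ^ 2) • h i =
      (1 + (p : FreeAlgebra ℤ (Fin 4)) * FreeAlgebra.ι ℤ (i + 1)) *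
        (1 + (p : FreeAlgebra ℤ (Fin 4)) * FreeAlgebra.ι ℤ i) -
      (1 + (p : FreeAlgebra ℤ (Fin 4)) * FreeAlgebra.ι ℤ i) *
        (1 + (p : FreeAlgebra ℤ (Fin 4)) * FreeAlgebra.ι ℤ (i + 1)) ^ k)
    (g : Fin 4 → FreeAlgebra (ZMod (p ^ n)) (Fin 4))
    (hg : ∀ i, g i = FreeAlgebra.lift ℤ (fun j => FreeAlgebra.ι (ZMod (p ^ n)) j) (h i)) :
    let I := TwoSidedIdeal.span {g 0, g 1, g 2, g 3}
    let b : {w : List (Fin 4) // ∀ j ∈ w, j = 0 ∨ j = 2} ×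
            {u : List (Fin 4) // ∀ j ∈ u, j = 1 ∨ j = 3} → I.ringCon.Quotient := fun wu =>
      RingCon.mk' I.ringCon
        (((wu.1 : List (Fin 4)).map (FreeAlgebra.ι (ZMod (p ^ n)))).prod *
         ((wu.2 : List (Fin 4)).map (FreeAlgebra.ι (ZMod (p ^ n)))).prod)
    LinearIndependent (ZMod (p ^ n)) b ∧
      Submodule.span (ZMod (p ^ n)) (Set.range b) = ⊤ := by
  obtain ⟨q, hq⟩ := exists_one_add_X_pow (by omega) hdvd
  have hp0 : IsNilpotent (p : ZMod (p ^ n)) := ⟨n, by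
    rw [← Nat.cast_pow, ZMod.natCast_self]⟩
  obtain ⟨σ, δ, hδ, hσX, hδX⟩ :=
    exists_skewDerivation_algEquiv hp0 (q.map (algebraMap ℤ (ZMod (p ^ n))))
  refine words_basis_of_relations hδ g fun i => ?_
  rw [hg, eq_of_sq_smul_eq hp.ne_zero hq (hh i), hσX, hδX]
  simp only [map_sub, map_add, map_mul, map_natCast, map_aeval_int,
    FreeAlgebra.lift_ι_apply, Polynomial.aeval_X, Polynomial.aeval_map_algebraMap]
end
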